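/- arXiv:1504.06101 — 10 statements merged into one kernel-verified Lean document; each statement's English description precedes it below -/
import Mathlib

section
/- Let Ω ⊂ ℝ^N be an open bounded convex set. If a convex map φ^− : ℝ^N → ℝ agrees with a concave map φ^+ : ℝ^N → ℝ on the boundary of Ω, then the common restriction φ := φ^−|_{∂Ω} = φ^+|_{∂Ω} satisfies the bounded slope condition of rank K, where K is any common Lipschitz constant for φ^− and φ^+ on the closure of Ω. -/
open MeasureTheory Filter
open scoped InnerProductSpace RealInnerProductSpace ENNReal NNReal Topology

noncomputable section

/-- bounded slope condition of rank `K` for `φ` on `∂Ω`. -/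
def BoundedSlope {N : ℕ} (Ω : Set (EuclideanSpace ℝ (Fin N)))
    (φ : EuclideanSpace ℝ (Fin N) → ℝ) (K : ℝ) : Prop :=
  ∀ y ∈ frontier Ω, ∃ ζm ζp : EuclideanSpace ℝ (Fin N), ‖ζm‖ ≤ K ∧ ‖ζp‖ ≤ K ∧
    ∀ x ∈ frontier Ω, φ y + ⟪ζm, x - y⟫ ≤ φ x ∧ φ x ≤ φ y + ⟪ζp, x - y⟫

/-- A convex function that is `K`-Lipschitz from below at `y ∈ s` has a subgradient at `y`,
relative to `s`, of norm at most `K`. -/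
theorem ConvexOn.exists_subgradient_norm_le {E : Type*} [NormedAddCommGroup E] [NormedSpace ℝ E]
    {s : Set E} {f : E → ℝ} {K : ℝ} {y : E} (hf : ConvexOn ℝ s f) (hK : 0 ≤ K) (hy : y ∈ s)
    (hlip : ∀ x ∈ s, f y - K * ‖x - y‖ ≤ f x) :
    ∃ g : E →L[ℝ] ℝ, ‖g‖ ≤ K ∧ ∀ x ∈ s, f y + g (x - y) ≤ f x := by
  have hcone : ConvexOn ℝ Set.univ fun x : E => K * ‖x - y‖ := by
    simpa [dist_eq_norm] using (convexOn_univ_dist y).smul hK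
  have hB : Convex ℝ {p : E × ℝ | p.2 < f y - K * ‖p.1 - y‖} := by
    simpa using ((concaveOn_const (f y) convex_univ).sub hcone).convex_strict_hypograph
  have hBo : IsOpen {p : E × ℝ | p.2 < f y - K * ‖p.1 - y‖} :=
    isOpen_lt (by fun_prop) (by fun_prop)
  have hdisj : Disjoint {p : E × ℝ | p.2 < f y - K * ‖p.1 - y‖}
      {p : E × ℝ | p.1 ∈ s ∧ f p.1 ≤ p.2} := by
    rw [Set.disjoint_left]
    rintro ⟨x, t⟩ hxB ⟨hxs, hxt⟩
    have := hlip x hxs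
    simp only [Set.mem_ofPred_eq] at hxB hxt
    linarith
  obtain ⟨L, u, hLB, hLA⟩ := geometric_hahn_banach_open hB hBo hf.convex_epigraph hdisj
  set l : E →L[ℝ] ℝ := L.comp (ContinuousLinearMap.inl ℝ E ℝ) with hl
  set c : ℝ := L (0, 1) with hc
  have hL (x : E) (t : ℝ) : L (x, t) = l x + t * c := by
    have : ((x, t) : E × ℝ) = (x, 0) + t • ((0, 1) : E × ℝ) := by simp
    rw [this, map_add, map_smul]
    simp [hl, hc]
  have hyA : u ≤ l y + f y * c := by
    simpa [hL] using hLA (y, f y) ⟨hy, le_rfl⟩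
  have hB' (x : E) (ε : ℝ) (hε : 0 < ε) : l x + (f y - K * ‖x - y‖ - ε) * c < u := by
    simpa [hL] using hLB (x, f y - K * ‖x - y‖ - ε) (by simpa using hε)
  have hcpos : 0 < c := by
    have := hB' y 1 one_pos
    simp only [sub_self, norm_zero, mul_zero, sub_zero] at this
    linarith
  have hu : l y + f y * c ≤ u := by
    refine le_of_forall_pos_le_add fun ε hε => ?_
    have := hB' y (ε / c) (div_pos hε hcpos)
    simp only [sub_self, norm_zero, mul_zero, sub_zero, sub_mul, div_mul_cancel₀ ε hcpos.ne']
      at this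
    linarith
  have hbound (v : E) : l v ≤ c * (K * ‖v‖) := by
    refine le_of_forall_pos_le_add fun ε hε => ?_
    have := hB' (y + v) (ε / c) (div_pos hε hcpos)
    simp only [add_sub_cancel_left, map_add, sub_mul, div_mul_cancel₀ ε hcpos.ne'] at this
    linarith
  refine ⟨-(c⁻¹ • l), ?_, fun x hx => ?_⟩
  · refine ContinuousLinearMap.opNorm_le_bound _ hK fun v => ?_
    have h₁ := hbound v
    have h₂ := hbound (-v)
    rw [map_neg, norm_neg] at h₂
    have h₃ : |l v| ≤ c * (K * ‖v‖) := abs_le.2 ⟨by linarith, h₁⟩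
    simp only [neg_apply, smul_apply, smul_eq_mul,
      norm_neg, Real.norm_eq_abs, abs_mul, abs_inv, abs_of_pos hcpos]
    rwa [inv_mul_le_iff₀ hcpos]
  · have h₁ : u ≤ l x + f x * c := by simpa [hL] using hLA (x, f x) ⟨hx, le_rfl⟩
    have h₂ : f y - f x ≤ c⁻¹ * l (x - y) := by
      rw [le_inv_mul_iff₀ hcpos, map_sub]
      linarith
    simp only [neg_apply, smul_apply, smul_eq_mul]
    linarith

/-- In a Hilbert space, a convex Lipschitz function has, at every point of its domain, a
subgradient vector bounded by the Lipschitz constant. -/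
theorem ConvexOn.exists_inner_subgradient_norm_le {E : Type*} [NormedAddCommGroup E]
    [InnerProductSpace ℝ E] [CompleteSpace E] {s : Set E} {f : E → ℝ} {K : ℝ≥0} {y : E}
    (hf : ConvexOn ℝ s f) (hlip : LipschitzOnWith K f s) (hy : y ∈ s) :
    ∃ ζ : E, ‖ζ‖ ≤ K ∧ ∀ x ∈ s, f y + ⟪ζ, x - y⟫ ≤ f x := by
  obtain ⟨g, hg, hgs⟩ := hf.exists_subgradient_norm_le K.coe_nonneg hy fun x hx => by
    have := hlip.dist_le_mul x hx y hy
    rw [Real.dist_eq, dist_eq_norm] at this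
    linarith [neg_abs_le (f x - f y)]
  refine ⟨(InnerProductSpace.toDual ℝ E).symm g, by simpa using hg, fun x hx => ?_⟩
  simpa only [InnerProductSpace.toDual_symm_apply] using hgs x hx

/-- **Lemma 2.4 (converse part).** If a convex `φ⁻ : ℝ^N → ℝ` agrees with a concave
`φ⁺ : ℝ^N → ℝ` on `∂Ω`, where `Ω` is open bounded convex, then their common restriction
to `∂Ω` satisfies the bounded slope condition of rank `K`, where `K` is any common
Lipschitz constant of `φ⁻` and `φ⁺` on the closure of `Ω`. -/
theorem bounded_slope_of_convex_concave_agreement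
    {N : ℕ} (Ω : Set (EuclideanSpace ℝ (Fin N)))
    (φm φp : EuclideanSpace ℝ (Fin N) → ℝ) (K : ℝ) (hK : 0 ≤ K)
    (hΩo : IsOpen Ω) (hΩb : Bornology.IsBounded Ω) (hΩc : Convex ℝ Ω)
    (hconv : ConvexOn ℝ Set.univ φm) (hconc : ConcaveOn ℝ Set.univ φp)
    (hagree : ∀ x ∈ frontier Ω, φm x = φp x)
    (hlipm : LipschitzOnWith (Real.toNNReal K) φm (closure Ω))
    (hlipp : LipschitzOnWith (Real.toNNReal K) φp (closure Ω)) :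
    BoundedSlope Ω φm K := by
  intro y hy
  have hyc := frontier_subset_closure hy
  obtain ⟨ζm, hζm, hm⟩ :=
    (hconv.subset (Set.subset_univ _) hΩc.closure).exists_inner_subgradient_norm_le hlipm hyc
  obtain ⟨ζp, hζp, hp⟩ :=
    (hconc.subset (Set.subset_univ _) hΩc.closure).neg.exists_inner_subgradient_norm_le
      hlipp.neg hyc
  rw [Real.coe_toNNReal K hK] at hζm hζp
  refine ⟨ζm, -ζp, hζm, by rwa [norm_neg], fun x hx =>
    ⟨hm x (frontier_subset_closure hx), ?_⟩⟩
  have := hp x (frontier_subset_closure hx)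
  rw [hagree x hx, hagree y hy, inner_neg_left]
  simp only [Pi.neg_apply] at this
  linarith

end
end

section
/- Let Ω ⊂ ℝ^N be a convex bounded open set and let φ : ∂Ω → ℝ satisfy the bounded slope condition of rank K. Then there exist a sequence {Ω_k} of smooth bounded uniformly convex open sets and a sequence of (K+1)-Lipschitz functions φ_k : ℝ^N → ℝ such that: (i) the closure of Ω is contained in Ω_k for every k, diam(Ω_k) ≤ diam(Ω) + 8β_Ω/k for a constant β_Ω > 0 depending only on Ω, |Ω_k \ Ω| → 0 as k → ∞, and max_{y∈∂Ω} min_{y'∈∂Ω_k} |y − y'| → 0 as k → ∞; (ii) the restriction of φ_k to ∂Ω_k is smooth and satisfies the bounded slope condition of rank K+2; (iii) φ_k coincides with φ on ∂Ω. -/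
open MeasureTheory Filter
open scoped InnerProductSpace RealInnerProductSpace ENNReal NNReal Topology

noncomputable section

/-- A smooth bounded uniformly convex open set: the sublevel set of a smooth uniformly
convex defining function with nonvanishing gradient on the boundary. -/
def SmoothUniformlyConvexDomain {N : ℕ} (U : Set (EuclideanSpace ℝ (Fin N))) : Prop :=
  IsOpen U ∧ Bornology.IsBounded U ∧ Convex ℝ U ∧
  ∃ j : EuclideanSpace ℝ (Fin N) → ℝ, ContDiff ℝ (⊤ : ℕ∞) j ∧
    (∃ lam : ℝ, 0 < lam ∧ ∀ x η : EuclideanSpace ℝ (Fin N),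
      lam * ‖η‖^2 ≤ iteratedFDeriv ℝ 2 j x ![η, η]) ∧
    U = {x | j x < 0} ∧ ∀ x ∈ frontier U, fderiv ℝ j x ≠ 0

section ConvexFunctions

variable {E : Type*} [NormedAddCommGroup E] [InnerProductSpace ℝ E]

/-- A function on `S` with affine minorants of slope at most `K` touching it at every point
extends to a convex `K`-Lipschitz function on the whole space. -/
theorem exists_convexOn_lipschitzWith_eqOn {S : Set E} {φ : E → ℝ} {ζ : E → E} {K : ℝ≥0}
    (hS : S.Nonempty) (hζ : ∀ y ∈ S, ‖ζ y‖ ≤ K)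
    (h : ∀ y ∈ S, ∀ x ∈ S, φ y + ⟪ζ y, x - y⟫ ≤ φ x) :
    ∃ F : E → ℝ, ConvexOn ℝ Set.univ F ∧ LipschitzWith K F ∧ Set.EqOn F φ S := by
  have hne : Nonempty S := hS.to_subtype
  let F : E → ℝ := fun x => ⨆ y : S, (φ y + ⟪ζ y, x - y⟫)
  have hinner : ∀ y ∈ S, ∀ v : E, ⟪ζ y, v⟫ ≤ K * ‖v‖ := fun y hy v =>
    (real_inner_le_norm _ _).trans (mul_le_mul_of_nonneg_right (hζ y hy) (norm_nonneg v))
  have hshift : ∀ (y x x' : E), φ y + ⟪ζ y, x - y⟫ = φ y + ⟪ζ y, x' - y⟫ + ⟪ζ y, x - x'⟫ := by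
    intro y x x'
    rw [add_assoc, ← inner_add_right]
    congr 2
    abel
  have hbdd : ∀ x, BddAbove (Set.range fun y : S => φ y + ⟪ζ y, x - y⟫) := by
    obtain ⟨y₀, hy₀⟩ := hS
    rintro x
    refine ⟨φ y₀ + K * ‖x - y₀‖, ?_⟩
    rintro _ ⟨⟨y, hy⟩, rfl⟩
    have h1 := h y hy y₀ hy₀
    have h2 := hinner y hy (x - y₀)
    have h3 := hshift y x y₀
    dsimp only
    linarith
  have hle : ∀ y ∈ S, ∀ x, φ y + ⟪ζ y, x - y⟫ ≤ F x := fun y hy x => le_ciSup (hbdd x) ⟨y, hy⟩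
  refine ⟨F, ⟨convex_univ, ?_⟩, ?_, ?_⟩
  · intro x _ x' _ a b ha hb hab
    refine ciSup_le fun ⟨y, hy⟩ => ?_
    have h1 := mul_le_mul_of_nonneg_left (hle y hy x) ha
    have h2 := mul_le_mul_of_nonneg_left (hle y hy x') hb
    have h3 : φ y + ⟪ζ y, a • x + b • x' - y⟫
        = a * (φ y + ⟪ζ y, x - y⟫) + b * (φ y + ⟪ζ y, x' - y⟫) := by
      have hb' : b = 1 - a := by linarith
      subst hb'
      simp only [inner_sub_right, inner_add_right, inner_smul_right]
      ring
    simp only [smul_eq_mul]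
    linarith
  · refine LipschitzWith.of_le_add_mul K fun x x' => ciSup_le fun ⟨y, hy⟩ => ?_
    have h1 := hle y hy x'
    have h2 := hinner y hy (x - x')
    have h3 := hshift y x x'
    rw [dist_eq_norm]
    linarith
  · intro x hx
    refine le_antisymm (ciSup_le fun ⟨y, hy⟩ => h y hy x hx) ?_
    simpa using hle x hx x

/-- Mollification keeps convexity and the Lipschitz constant. -/
theorem exists_contDiff_convexOn_lipschitzWith_dist_le [FiniteDimensional ℝ E]
    {F : E → ℝ} {L : ℝ≥0} (hF : ConvexOn ℝ Set.univ F) (hL : LipschitzWith L F) {τ : ℝ}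
    (hτ : 0 < τ) :
    ∃ A : E → ℝ, ContDiff ℝ (⊤ : ℕ∞) A ∧ ConvexOn ℝ Set.univ A ∧ LipschitzWith L A ∧
      ∀ x, |A x - F x| ≤ τ := by
  borelize E
  let μ : Measure E := .addHaar
  have hδ : 0 < τ / (L + 1) := by positivity
  let ρ : ContDiffBump (0 : E) := ⟨τ / (L + 1) / 2, τ / (L + 1), half_pos hδ, half_lt_self hδ⟩
  let A : E → ℝ := fun x => ∫ t, ρ.normed μ t * F (x - t) ∂μ
  have hconv : A = (convolution (ρ.normed μ) F (ContinuousLinearMap.lsmul ℝ ℝ) μ) := by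
    ext x
    simp [A, convolution]
  have hint : ∀ x, Integrable (fun t => ρ.normed μ t * F (x - t)) μ := by
    intro x
    refine Continuous.integrable_of_hasCompactSupport ?_ ?_
    · exact ρ.continuous_normed.mul (hL.continuous.comp (by fun_prop))
    · exact ρ.hasCompactSupport_normed.mul_right
  refine ⟨A, ?_, ⟨convex_univ, ?_⟩, ?_, ?_⟩
  · rw [hconv]
    exact ρ.hasCompactSupport_normed.contDiff_convolution_left _ ρ.contDiff_normed
      hL.continuous.locallyIntegrable
  · intro x _ x' _ a b ha hb hab
    simp only [A, smul_eq_mul]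
    rw [← integral_const_mul, ← integral_const_mul, ← integral_add ((hint x).const_mul a)
      ((hint x').const_mul b)]
    refine integral_mono (hint _) (((hint x).const_mul a).add ((hint x').const_mul b))
      fun t => ?_
    have h1 := hF.2 (Set.mem_univ (x - t)) (Set.mem_univ (x' - t)) ha hb hab
    have h2 : a • (x - t) + b • (x' - t) = a • x + b • x' - t := by
      have : (a + b) • t = t := by rw [hab, one_smul]
      rw [smul_sub, smul_sub]
      nth_rewrite 3 [← this]
      rw [add_smul]
      abel
    rw [h2] at h1
    have h3 := mul_le_mul_of_nonneg_left h1 (ρ.nonneg_normed (μ := μ) t)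
    simp only [smul_eq_mul] at h3
    dsimp only
    linarith
  · refine LipschitzWith.of_le_add_mul L fun x x' => ?_
    have hone : (L : ℝ) * dist x x' = ∫ t, ρ.normed μ t * (L * dist x x') ∂μ := by
      rw [integral_mul_const, ρ.integral_normed, one_mul]
    have hi : Integrable (fun t => ρ.normed μ t * (L * dist x x')) μ :=
      ρ.integrable_normed.mul_const _
    rw [hone]
    simp only [A]
    rw [← integral_add (hint x') hi]
    refine integral_mono (hint x) ((hint x').add hi) fun t => ?_
    have h1 : F (x - t) ≤ F (x' - t) + L * dist x x' := by
      simpa using hL.le_add_mul (x - t) (x' - t)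
    have h3 := mul_le_mul_of_nonneg_left h1 (ρ.nonneg_normed (μ := μ) t)
    dsimp only
    linarith
  · intro x
    rw [← Real.dist_eq, hconv]
    refine ρ.dist_normed_convolution_le hL.continuous.aestronglyMeasurable fun y hy => ?_
    refine (hL.dist_le_mul y x).trans ?_
    have h1 : dist y x < τ / (L + 1) := hy
    have h2 : (L : ℝ) * dist y x ≤ (L + 1) * (τ / (L + 1)) := by
      gcongr
      linarith
    rwa [mul_div_cancel₀ τ (by positivity : (L : ℝ) + 1 ≠ 0)] at h2

/-- A differentiable convex function lies above its tangent planes. -/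
theorem ConvexOn.add_fderiv_le {A : E → ℝ} (hA : ConvexOn ℝ Set.univ A)
    (hd : Differentiable ℝ A) (x y : E) : A y + fderiv ℝ A y (x - y) ≤ A x := by
  have hline : ConvexOn ℝ Set.univ (fun t : ℝ => A (AffineMap.lineMap y x t)) :=
    hA.comp_affineMap (AffineMap.lineMap y x)
  have hder : HasDerivAt (fun t : ℝ => A (AffineMap.lineMap y x t)) (fderiv ℝ A y (x - y)) 0 := by
    have h1 : HasFDerivAt A (fderiv ℝ A y) (AffineMap.lineMap y x (0 : ℝ)) := by
      simpa using (hd y).hasFDerivAt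
    exact h1.comp_hasDerivAt (0 : ℝ) (AffineMap.hasDerivAt_lineMap (a := y) (b := x))
  have h := hline.le_slope_of_hasDerivAt (Set.mem_univ 0) (Set.mem_univ 1) one_pos hder
  simp only [slope_def_field, AffineMap.lineMap_apply_one, AffineMap.lineMap_apply_zero] at h
  linarith

/-- If `j - c ‖·‖²` is convex, then the Hessian of `j` is bounded below by `2 c`. -/
theorem two_mul_le_iteratedFDeriv_two_of_convexOn_sub {j : E → ℝ} {c : ℝ}
    (hj : ContDiff ℝ 2 j) (hc : ConvexOn ℝ Set.univ fun x => j x - c * ‖x‖ ^ 2) (x v : E) :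
    2 * c * ‖v‖ ^ 2 ≤ iteratedFDeriv ℝ 2 j x ![v, v] := by
  have hj1 : Differentiable ℝ j := hj.differentiable (by norm_num)
  have hj2 : Differentiable ℝ (fderiv ℝ j) :=
    (hj.fderiv_right (m := 1) (by norm_num)).differentiable (by norm_num)
  have hl : ∀ t : ℝ, HasDerivAt (fun t : ℝ => x + t • v) v t := fun t => by
    simpa using ((hasDerivAt_id t).smul_const v).const_add x
  have hd : ∀ t : ℝ, HasDerivAt (fun t : ℝ => j (x + t • v) - c * ‖x + t • v‖ ^ 2)
      (fderiv ℝ j (x + t • v) v - c * (2 * ⟪x + t • v, v⟫)) t := fun t =>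
    ((hj1 _).hasFDerivAt.comp_hasDerivAt t (hl t)).sub (((hl t).norm_sq).const_mul c)
  have hconv : ConvexOn ℝ Set.univ (fun t : ℝ => j (x + t • v) - c * ‖x + t • v‖ ^ 2) := by
    have := hc.comp_affineMap (AffineMap.lineMap x (x + v))
    simpa [Function.comp_def, AffineMap.lineMap_apply, add_comm] using this
  have hmono : Monotone fun t : ℝ => fderiv ℝ j (x + t • v) v - c * (2 * ⟪x + t • v, v⟫) := by
    have h1 := hconv.monotoneOn_deriv fun t _ => (hd t).differentiableAt
    rw [monotoneOn_univ] at h1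
    convert h1 using 1
    exact (funext fun t => (hd t).deriv).symm
  have hdd : HasDerivAt (fun t : ℝ => fderiv ℝ j (x + t • v) v - c * (2 * ⟪x + t • v, v⟫))
      (fderiv ℝ (fderiv ℝ j) x v v - c * (2 * ⟪v, v⟫)) 0 := by
    have h1 : HasFDerivAt (fun y => fderiv ℝ j y v)
        ((ContinuousLinearMap.apply ℝ ℝ v).comp (fderiv ℝ (fderiv ℝ j) x)) (x + (0 : ℝ) • v) := by
      rw [zero_smul, add_zero]
      exact ((ContinuousLinearMap.apply ℝ ℝ v).hasFDerivAt (x := fderiv ℝ j x)).comp x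
        (hj2 x).hasFDerivAt
    have h2 : HasDerivAt (fun t : ℝ => fderiv ℝ j (x + t • v) v)
        (fderiv ℝ (fderiv ℝ j) x v v) 0 := by
      have h := h1.comp_hasDerivAt (0 : ℝ) (hl 0)
      exact h
    have h3 : HasDerivAt (fun t : ℝ => ⟪x + t • v, v⟫) ⟪v, v⟫ 0 := by
      simpa using (hl 0).inner ℝ (hasDerivAt_const (0 : ℝ) v)
    exact h2.sub ((h3.const_mul 2).const_mul c)
  have hnn : 0 ≤ fderiv ℝ (fderiv ℝ j) x v v - c * (2 * ⟪v, v⟫) := by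
    rw [← hdd.deriv]
    exact hmono.deriv_nonneg
  rw [iteratedFDeriv_two_apply]
  simp only [Matrix.cons_val_zero, Matrix.cons_val_one]
  rw [real_inner_self_eq_norm_sq] at hnn
  linarith

theorem isPreconnected_inter_frontier_nonempty {X : Type*} [TopologicalSpace X] {s u : Set X}
    (hs : IsPreconnected s) (hu : IsOpen u) (h1 : (s ∩ u).Nonempty) (h2 : (s \ u).Nonempty) :
    (s ∩ frontier u).Nonempty := by
  by_contra hcon
  rw [Set.not_nonempty_iff_eq_empty] at hcon
  obtain ⟨x, hx, hxu⟩ := h2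
  refine hxu (hs.subset_left_of_subset_union hu isClosed_closure.isOpen_compl
    (Set.disjoint_compl_right_iff_subset.2 subset_closure) (fun z hz => ?_) h1 hx)
  by_contra hz'
  simp only [Set.mem_union, Set.mem_compl_iff, not_or, not_not] at hz'
  have : z ∈ s ∩ frontier u := ⟨hz, by rw [hu.frontier_eq]; exact ⟨hz'.2, hz'.1⟩⟩
  rwa [hcon] at this

/-- A ray issued from a point of a bounded open set meets its frontier. -/
theorem exists_pos_add_smul_mem_frontier {U : Set E} (hU : IsOpen U)
    (hb : Bornology.IsBounded U) {x v : E} (hx : x ∈ U) (hv : v ≠ 0) :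
    ∃ t : ℝ, 0 < t ∧ x + t • v ∈ frontier U := by
  obtain ⟨R, hR⟩ := hb.subset_closedBall x
  have hcont : Continuous fun t : ℝ => x + t • v := by fun_prop
  have hv' : 0 < ‖v‖ := norm_pos_iff.2 hv
  obtain ⟨_, ⟨t, ht, rfl⟩, hf⟩ := isPreconnected_inter_frontier_nonempty
    ((isPreconnected_Ici (a := (0 : ℝ))).image _ hcont.continuousOn) hU
    ⟨x, ⟨0, Set.self_mem_Ici, by simp⟩, hx⟩
    ⟨x + ((|R| + 1) / ‖v‖) • v, ⟨_, Set.mem_Ici.2 (by positivity), rfl⟩, fun hmem => by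
      have h1 := hR hmem
      rw [mem_closedBall_iff_norm, add_sub_cancel_left, norm_smul, Real.norm_of_nonneg
        (by positivity), div_mul_cancel₀ _ hv'.ne'] at h1
      linarith [le_abs_self R]⟩
  refine ⟨t, lt_of_le_of_ne ht fun h0 => ?_, hf⟩
  subst h0
  simp only [zero_smul, add_zero, hU.frontier_eq] at hf
  exact hf.2 hx

/-- A convex function vanishing on the frontier of a bounded open set is nonpositive inside. -/
theorem ConvexOn.nonpos_of_eq_zero_on_frontier [Nontrivial E] {Ω : Set E} {d : E → ℝ}
    (hd : ConvexOn ℝ Set.univ d) (hΩ : IsOpen Ω) (hb : Bornology.IsBounded Ω)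
    (h0 : ∀ y ∈ frontier Ω, d y = 0) {x : E} (hx : x ∈ closure Ω) : d x ≤ 0 := by
  by_cases hxΩ : x ∈ Ω
  · obtain ⟨v, hv⟩ := exists_ne (0 : E)
    obtain ⟨s, hs, hs'⟩ := exists_pos_add_smul_mem_frontier hΩ hb hxΩ hv
    obtain ⟨t, ht, ht'⟩ := exists_pos_add_smul_mem_frontier hΩ hb hxΩ (neg_ne_zero.2 hv)
    have hst : 0 < s + t := add_pos hs ht
    have h := hd.2 (Set.mem_univ (x + s • v)) (Set.mem_univ (x + t • -v))
      (show 0 ≤ t / (s + t) by positivity) (show 0 ≤ s / (s + t) by positivity)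
      (by field_simp; ring)
    have hxe : (t / (s + t)) • (x + s • v) + (s / (s + t)) • (x + t • -v) = x := by
      have h1 : t / (s + t) + s / (s + t) = 1 := by field_simp; ring
      have h2 : (t / (s + t)) * s - (s / (s + t)) * t = 0 := by field_simp; ring
      calc _ = (t / (s + t) + s / (s + t)) • x
          + ((t / (s + t)) * s - (s / (s + t)) * t) • v := by module
        _ = x := by rw [h1, h2]; simp
    rw [hxe, h0 _ hs', h0 _ ht'] at h
    simpa using h
  · exact (h0 x (by rw [hΩ.frontier_eq]; exact ⟨hx, hxΩ⟩)).le

/-- A convex function vanishing on the frontier of a nonempty bounded open set is nonnegative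
outside. -/
theorem ConvexOn.nonneg_of_eq_zero_on_frontier [Nontrivial E] {Ω : Set E} {d : E → ℝ}
    (hd : ConvexOn ℝ Set.univ d) (hΩ : IsOpen Ω) (hb : Bornology.IsBounded Ω)
    (hne : Ω.Nonempty) (h0 : ∀ y ∈ frontier Ω, d y = 0) {x : E} (hx : x ∉ Ω) : 0 ≤ d x := by
  obtain ⟨z, hz⟩ := hne
  obtain ⟨y, hy, hyf⟩ := isPreconnected_inter_frontier_nonempty
    (convex_segment z x).isPreconnected hΩ ⟨z, left_mem_segment ℝ z x, hz⟩
    ⟨x, right_mem_segment ℝ z x, hx⟩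
  obtain ⟨a, b, ha, hb', hab, rfl⟩ := hy
  have h := hd.2 (Set.mem_univ z) (Set.mem_univ x) ha hb' hab
  rw [h0 _ hyf] at h
  have hdz := hd.nonpos_of_eq_zero_on_frontier hΩ hb h0 (subset_closure hz)
  have hbpos : 0 < b := by
    refine lt_of_le_of_ne hb' fun h0' => ?_
    have ha1 : a = 1 := by linarith
    rw [← h0', ha1, zero_smul, add_zero, one_smul, hΩ.frontier_eq] at hyf
    exact hyf.2 hz
  by_contra hneg
  push Not at hneg
  simp only [smul_eq_mul] at h
  nlinarith [mul_nonpos_of_nonneg_of_nonpos ha hdz, mul_neg_of_pos_of_neg hbpos hneg]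

theorem Convex.convexOn_infDist {s : Set E} (hs : Convex ℝ s) (hne : s.Nonempty) :
    ConvexOn ℝ Set.univ fun x => Metric.infDist x s := by
  refine ⟨convex_univ, fun x _ y _ a b ha hb hab => le_of_forall_pos_le_add fun ε hε => ?_⟩
  obtain ⟨p, hp, hxp⟩ := (Metric.infDist_lt_iff hne).1 (lt_add_of_pos_right (Metric.infDist x s) hε)
  obtain ⟨q, hq, hyq⟩ := (Metric.infDist_lt_iff hne).1 (lt_add_of_pos_right (Metric.infDist y s) hε)
  calc Metric.infDist (a • x + b • y) s ≤ dist (a • x + b • y) (a • p + b • q) :=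
        Metric.infDist_le_dist_of_mem (hs hp hq ha hb hab)
    _ ≤ dist (a • x) (a • p) + dist (b • y) (b • q) := dist_add_add_le _ _ _ _
    _ = a * dist x p + b * dist y q := by
        rw [dist_smul₀, dist_smul₀, Real.norm_of_nonneg ha, Real.norm_of_nonneg hb]
    _ ≤ a * (Metric.infDist x s + ε) + b * (Metric.infDist y s + ε) := by gcongr
    _ = a • Metric.infDist x s + b • Metric.infDist y s + ε := by
        have hb' : b = 1 - a := by linarith
        subst hb'
        simp only [smul_eq_mul]
        ring

/-- A frontier point of an open convex set is close to the frontier of every bounded open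
neighbourhood contained in a thin thickening of the set. -/
theorem exists_mem_frontier_dist_le [CompleteSpace E] {Ω U : Set E} (hΩ : IsOpen Ω)
    (hc : Convex ℝ Ω) (hne : Ω.Nonempty) (hU : IsOpen U) (hUb : Bornology.IsBounded U) {ε : ℝ}
    (hUε : U ⊆ Metric.thickening ε Ω) {y : E} (hyU : y ∈ U) (hy : y ∉ Ω) :
    ∃ y' ∈ frontier U, dist y y' ≤ ε := by
  obtain ⟨f, hf⟩ := geometric_hahn_banach_open_point hc hΩ hy
  set ν := (InnerProductSpace.toDual ℝ E).symm f with hν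
  have hfν : ∀ x, f x = ⟪ν, x⟫ := fun x => by
    rw [hν, InnerProductSpace.toDual_symm_apply]
  have hν0 : ν ≠ 0 := by
    intro h0
    obtain ⟨a, ha⟩ := hne
    have := hf a ha
    simp [hfν, h0] at this
  obtain ⟨t, ht, hyt⟩ := exists_pos_add_smul_mem_frontier hU hUb hyU hν0
  refine ⟨_, hyt, ?_⟩
  have hνpos : 0 < ‖ν‖ := norm_pos_iff.2 hν0
  have hcl : Metric.infDist (y + t • ν) Ω ≤ ε := by
    have hsub : U ⊆ {x | Metric.infDist x Ω ≤ ε} := fun x hx =>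
      ((Metric.mem_thickening_iff_infDist_lt hne).1 (hUε hx)).le
    exact closure_minimal hsub (isClosed_le (Metric.continuous_infDist_pt Ω) continuous_const)
      (frontier_subset_closure hyt)
  rw [dist_self_add_right, norm_smul, Real.norm_of_nonneg ht.le]
  refine le_trans ((Metric.le_infDist hne).2 fun a ha => ?_) hcl
  have h1 : ⟪ν, y + t • ν - a⟫ ≤ ‖ν‖ * ‖y + t • ν - a‖ := real_inner_le_norm _ _
  have h2 : ⟪ν, y + t • ν - a⟫ = f y - f a + t * ‖ν‖ ^ 2 := by
    rw [hfν, hfν, ← real_inner_self_eq_norm_sq, inner_sub_right, inner_add_right,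
      inner_smul_right]
    ring
  rw [dist_eq_norm]
  refine le_of_mul_le_mul_left ?_ hνpos
  nlinarith [hf a ha]

theorem norm_sq_add_inner_le (x y : E) : ‖y‖ ^ 2 + 2 * ⟪y, x - y⟫ ≤ ‖x‖ ^ 2 := by
  have h := norm_add_sq_real y (x - y)
  rw [add_sub_cancel] at h
  nlinarith [sq_nonneg ‖x - y‖]

end ConvexFunctions

section Approximation

variable {N : ℕ}

theorem smoothUniformlyConvexDomain_setOf_lt_zero {j : EuclideanSpace ℝ (Fin N) → ℝ} {c : ℝ}
    (hc : 0 < c) (hj : ContDiff ℝ (⊤ : ℕ∞) j)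
    (hjc : ConvexOn ℝ Set.univ fun x => j x - c * ‖x‖ ^ 2)
    (hb : Bornology.IsBounded {x | j x < 0}) : SmoothUniformlyConvexDomain {x | j x < 0} := by
  have hconv : ConvexOn ℝ Set.univ j := by
    have h2 : ConvexOn ℝ Set.univ fun x : EuclideanSpace ℝ (Fin N) => c * ‖x‖ ^ 2 :=
      (convexOn_univ_norm.pow (fun x _ => norm_nonneg x) 2).smul hc.le
    exact (hjc.add h2).congr fun x _ => by simp
  have hopen : IsOpen {x | j x < 0} := isOpen_lt hj.continuous continuous_const
  refine ⟨hopen, hb, ?_, j, hj, ⟨2 * c, by positivity, fun x η => ?_⟩, rfl, fun x hx h0 => ?_⟩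
  · simpa using hconv.convex_lt 0
  · exact two_mul_le_iteratedFDeriv_two_of_convexOn_sub (contDiff_infty.1 hj 2) hjc x η
  · obtain ⟨z, hz⟩ := closure_nonempty_iff.1 ⟨x, frontier_subset_closure hx⟩
    have h1 := hconv.add_fderiv_le (hj.differentiable (by simp)) z x
    rw [hopen.frontier_eq] at hx
    have h2 : 0 ≤ j x := not_lt.1 hx.2
    simp only [h0, zero_apply, add_zero] at h1
    have h3 : j z < 0 := hz
    linarith

theorem smoothUniformlyConvexDomain_of_frontier_eq_empty {Ω : Set (EuclideanSpace ℝ (Fin N))}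
    (hb : Bornology.IsBounded Ω) (h : frontier Ω = ∅) : SmoothUniformlyConvexDomain Ω := by
  have key : ∀ a : ℝ, Bornology.IsBounded {x : EuclideanSpace ℝ (Fin N) | ‖x‖ ^ 2 + a < 0} →
      SmoothUniformlyConvexDomain {x : EuclideanSpace ℝ (Fin N) | ‖x‖ ^ 2 + a < 0} := fun a =>
    smoothUniformlyConvexDomain_setOf_lt_zero one_pos ((contDiff_norm_sq ℝ).add contDiff_const)
      (by simpa using convexOn_const a convex_univ)
  rcases frontier_eq_empty_iff.1 h with rfl | rfl
  · have he : {x : EuclideanSpace ℝ (Fin N) | ‖x‖ ^ 2 + 1 < 0} = ∅ := by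
      ext x
      simp only [Set.mem_ofPred_eq, Set.mem_empty_iff_false, iff_false, not_lt]
      positivity
    have := key 1
    rw [he] at this
    exact this hb
  · have hs : Subsingleton (EuclideanSpace ℝ (Fin N)) := by
      by_contra hns
      rw [not_subsingleton_iff_nontrivial] at hns
      exact NormedSpace.unbounded_univ ℝ (EuclideanSpace ℝ (Fin N)) hb
    have he : {x : EuclideanSpace ℝ (Fin N) | ‖x‖ ^ 2 + (-1) < 0} = Set.univ := by
      ext x
      simp [Subsingleton.elim x 0]
    have := key (-1)
    rw [he] at this
    exact this hb

theorem BoundedSlope.lipschitzOnWith {Ω : Set (EuclideanSpace ℝ (Fin N))}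
    {φ : EuclideanSpace ℝ (Fin N) → ℝ} {K : ℝ≥0} (h : BoundedSlope Ω φ K) :
    LipschitzOnWith K φ (frontier Ω) := by
  refine LipschitzOnWith.of_le_add_mul K fun x hx y hy => ?_
  obtain ⟨_, ζ, _, hζ, hxy⟩ := h y hy
  have h1 : ⟪ζ, x - y⟫ ≤ K * ‖x - y‖ :=
    (real_inner_le_norm _ _).trans (mul_le_mul_of_nonneg_right hζ (norm_nonneg _))
  rw [dist_eq_norm]
  linarith [(hxy x hx).2]

/-- Bounded slope data extend to a convex function `F` and a concave function `-G` which agree on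
the frontier, lie in the right order inside, and separate linearly outside. -/
theorem BoundedSlope.exists_convexOn_pair {Ω : Set (EuclideanSpace ℝ (Fin N))}
    {φ : EuclideanSpace ℝ (Fin N) → ℝ} {K : ℝ≥0} (h : BoundedSlope Ω φ K) (hΩo : IsOpen Ω)
    (hΩb : Bornology.IsBounded Ω) (hΩc : Convex ℝ Ω) (hne : (frontier Ω).Nonempty) :
    ∃ F G : EuclideanSpace ℝ (Fin N) → ℝ, ConvexOn ℝ Set.univ F ∧ ConvexOn ℝ Set.univ G ∧
      LipschitzWith (K + 1 / 2) F ∧ LipschitzWith (K + 1 / 2) G ∧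
      (∀ x ∈ frontier Ω, F x = φ x) ∧ (∀ x ∈ frontier Ω, G x = -φ x) ∧
      (∀ x ∈ closure Ω, F x + G x ≤ 0) ∧ ∀ x, x ∉ closure Ω → Metric.infDist x Ω ≤ F x + G x := by
  have hneΩ : Ω.Nonempty := by
    obtain ⟨x, hx⟩ := hne
    exact closure_nonempty_iff.1 ⟨x, frontier_subset_closure hx⟩
  have hnt : Nontrivial (EuclideanSpace ℝ (Fin N)) := by
    obtain ⟨x, hx⟩ := hne
    obtain ⟨y, hy⟩ := hneΩ
    rw [hΩo.frontier_eq] at hx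
    exact ⟨x, y, fun hxy => hx.2 (hxy ▸ hy)⟩
  choose! ζm ζp hm hp hslope using h
  obtain ⟨F, hFc, hFL, hF⟩ := exists_convexOn_lipschitzWith_eqOn hne hm
    fun y hy x hx => (hslope y hy x hx).1
  obtain ⟨G, hGc, hGL, hG⟩ := exists_convexOn_lipschitzWith_eqOn (φ := fun x => -φ x)
    (ζ := fun y => -ζp y) hne (fun y hy => by simpa using hp y hy) fun y hy x hx => by
      rw [inner_neg_left]
      linarith [(hslope y hy x hx).2]
  have hdist := hΩc.convexOn_infDist hneΩ
  have hdist' : ConvexOn ℝ Set.univ fun x => (1 / 2 : ℝ) * Metric.infDist x Ω :=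
    hdist.smul (by norm_num)
  have hdL : LipschitzWith (1 / 2) fun x => (1 / 2 : ℝ) * Metric.infDist x Ω := by
    refine LipschitzWith.of_le_add_mul _ fun x y => ?_
    have h1 := Metric.infDist_le_infDist_add_dist (s := Ω) (x := x) (y := y)
    push_cast
    linarith
  have hd0 : ∀ x ∈ closure Ω, Metric.infDist x Ω = 0 := fun x hx =>
    (Metric.mem_closure_iff_infDist_zero hneΩ).1 hx
  have hzero : ∀ x ∈ frontier Ω, F x + G x = 0 := fun x hx => by rw [hF hx, hG hx]; ring
  have hFG : ConvexOn ℝ Set.univ fun x => F x + G x := hFc.add hGc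
  refine ⟨_, _, hFc.add hdist', hGc.add hdist', hFL.add hdL, hGL.add hdL, fun x hx => ?_,
    fun x hx => ?_, fun x hx => ?_, fun x hx => ?_⟩
  · simp [hF hx, hd0 x (frontier_subset_closure hx)]
  · simp [hG hx, hd0 x (frontier_subset_closure hx)]
  · have := hFG.nonpos_of_eq_zero_on_frontier hΩo hΩb hzero hx
    simpa [hd0 x hx] using this
  · have := hFG.nonneg_of_eq_zero_on_frontier hΩo hΩb hneΩ hzero
      (fun hxΩ => hx (subset_closure hxΩ))
    simp only [Pi.add_apply]
    linarith

/-- One-sided slope bound for a smooth Lipschitz convex function plus a small paraboloid. -/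
theorem exists_slope_of_convexOn {A : EuclideanSpace ℝ (Fin N) → ℝ} {L : ℝ≥0}
    (hA : ConvexOn ℝ Set.univ A) (hd : Differentiable ℝ A) (hL : LipschitzWith L A) {η M : ℝ}
    (hη : 0 ≤ η) {y : EuclideanSpace ℝ (Fin N)} (hy : ‖y‖ ≤ M) :
    ∃ ζ : EuclideanSpace ℝ (Fin N), ‖ζ‖ ≤ L + 2 * η * M ∧
      ∀ x, A y + η * ‖y‖ ^ 2 + ⟪ζ, x - y⟫ ≤ A x + η * ‖x‖ ^ 2 := by
  refine ⟨(InnerProductSpace.toDual ℝ _).symm (fderiv ℝ A y) + (2 * η) • y, ?_, fun x => ?_⟩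
  · refine (norm_add_le _ _).trans (add_le_add ?_ ?_)
    · rw [LinearIsometryEquiv.norm_map]
      exact norm_fderiv_le_of_lipschitz ℝ hL
    · rw [norm_smul, Real.norm_of_nonneg (by positivity)]
      gcongr
  · rw [inner_add_left, InnerProductSpace.toDual_symm_apply, real_inner_smul_left]
    have h1 := hA.add_fderiv_le hd x y
    have h2 := mul_le_mul_of_nonneg_left (norm_sq_add_inner_le x y) hη
    linarith

/-- The approximation at a single scale `ε`: with `f` a smooth convex and `g` a smooth concave
approximation of `φ`, the domain is `{f < g}` and `f = g` holds on its frontier. -/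
theorem BoundedSlope.exists_smoothUniformlyConvexDomain {Ω : Set (EuclideanSpace ℝ (Fin N))}
    {φ : EuclideanSpace ℝ (Fin N) → ℝ} {K : ℝ≥0} (h : BoundedSlope Ω φ K) (hΩo : IsOpen Ω)
    (hΩb : Bornology.IsBounded Ω) (hΩc : Convex ℝ Ω) (hne : (frontier Ω).Nonempty) {ε : ℝ}
    (hε : 0 < ε) (hε1 : ε ≤ 1) :
    ∃ (U : Set (EuclideanSpace ℝ (Fin N))) (ψ : EuclideanSpace ℝ (Fin N) → ℝ),
      SmoothUniformlyConvexDomain U ∧ closure Ω ⊆ U ∧ U ⊆ Metric.thickening ε Ω ∧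
      LipschitzWith (K + 1) ψ ∧
      (∃ Ψ : EuclideanSpace ℝ (Fin N) → ℝ, ContDiff ℝ (⊤ : ℕ∞) Ψ ∧ ∀ x ∈ frontier U, ψ x = Ψ x) ∧
      BoundedSlope U ψ (K + 2) ∧ ∀ x ∈ frontier Ω, ψ x = φ x := by
  have hneΩ : Ω.Nonempty := by
    obtain ⟨x, hx⟩ := hne
    exact closure_nonempty_iff.1 ⟨x, frontier_subset_closure hx⟩
  obtain ⟨F, G, hFc, hGc, hFL, hGL, hFφ, hGφ, hin, hout⟩ :=
    h.exists_convexOn_pair hΩo hΩb hΩc hne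
  obtain ⟨R, hR, hΩR⟩ : ∃ R : ℝ, 0 < R ∧ Ω ⊆ Metric.closedBall 0 R := by
    obtain ⟨R, hR⟩ := hΩb.subset_closedBall 0
    exact ⟨|R| + 1, by positivity, hR.trans (Metric.closedBall_subset_closedBall
      (by linarith [le_abs_self R]))⟩
  set s : ℝ := ε / 4 with hs
  have hs0 : 0 < s := by positivity
  set η : ℝ := s / (4 * (R + 1) ^ 2) with hη
  have hη0 : 0 < η := by positivity
  have hη1 : η * (R + 1) ^ 2 = s / 4 := by rw [hη]; field_simp
  have hη2 : 2 * η * (R + 1) ≤ 1 / 2 := by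
    have h1 : η * (R + 1) ≤ η * (R + 1) ^ 2 := by gcongr; nlinarith
    linarith
  obtain ⟨A, hAs, hAc, hAL, hAF⟩ :=
    exists_contDiff_convexOn_lipschitzWith_dist_le hFc hFL (τ := s / 4) (by positivity)
  obtain ⟨B, hBs, hBc, hBL, hBG⟩ :=
    exists_contDiff_convexOn_lipschitzWith_dist_le hGc hGL (τ := s / 4) (by positivity)
  have hAd : Differentiable ℝ A := hAs.differentiable (by simp)
  have hBd : Differentiable ℝ B := hBs.differentiable (by simp)
  have hηM : ∀ x : EuclideanSpace ℝ (Fin N), ‖x‖ ≤ R + 1 → η * ‖x‖ ^ 2 ≤ s / 4 := fun x hx => by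
    rw [← hη1]
    gcongr
  set f : EuclideanSpace ℝ (Fin N) → ℝ := fun x => A x + η * ‖x‖ ^ 2 - s with hf
  set j : EuclideanSpace ℝ (Fin N) → ℝ := fun x => A x + B x + 2 * η * ‖x‖ ^ 2 - 2 * s with hj
  have hfs : ContDiff ℝ (⊤ : ℕ∞) f :=
    (hAs.add (contDiff_const.mul (contDiff_norm_sq ℝ))).sub contDiff_const
  have hjs : ContDiff ℝ (⊤ : ℕ∞) j :=
    ((hAs.add hBs).add (contDiff_const.mul (contDiff_norm_sq ℝ))).sub contDiff_const
  set U : Set (EuclideanSpace ℝ (Fin N)) := {x | j x < 0} with hU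
  have hUo : IsOpen U := isOpen_lt hjs.continuous continuous_const
  have hΩU : closure Ω ⊆ U := by
    intro x hx
    have hxR : ‖x‖ ≤ R := by
      simpa using closure_minimal hΩR Metric.isClosed_closedBall hx
    have h1 := hηM x (by linarith)
    have h2 := (abs_le.1 (hAF x)).2
    have h3 := (abs_le.1 (hBG x)).2
    have h4 := hin x hx
    change A x + B x + 2 * η * ‖x‖ ^ 2 - 2 * s < 0
    linarith
  have hUε : U ⊆ Metric.thickening ε Ω := by
    intro x hx
    by_cases hxΩ : x ∈ closure Ω
    · exact Metric.closure_subset_thickening hε Ω hxΩ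
    rw [Metric.mem_thickening_iff_infDist_lt hneΩ]
    have h1 : A x + B x + 2 * η * ‖x‖ ^ 2 - 2 * s < 0 := hx
    have h2 := (abs_le.1 (hAF x)).1
    have h3 := (abs_le.1 (hBG x)).1
    have h4 := hout x hxΩ
    have h5 : 0 ≤ η * ‖x‖ ^ 2 := by positivity
    linarith
  have hUb : Bornology.IsBounded U := hΩb.thickening.subset hUε
  have hUR : ∀ x ∈ frontier U, ‖x‖ ≤ R + 1 := by
    intro x hx
    have h1 : U ⊆ Metric.closedBall 0 (R + 1) := by
      intro z hz
      obtain ⟨w, hw, hzw⟩ := Metric.mem_thickening_iff.1 (hUε hz)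
      have h2 : ‖w‖ ≤ R := by simpa using hΩR hw
      rw [dist_eq_norm] at hzw
      have h3 := norm_add_le w (z - w)
      rw [add_sub_cancel] at h3
      simp only [mem_closedBall_iff_norm, sub_zero]
      linarith
    simpa using closure_minimal h1 Metric.isClosed_closedBall (frontier_subset_closure hx)
  have hfg : ∀ x ∈ frontier U, j x = 0 := by
    intro x hx
    refine le_antisymm ?_ ?_
    · have h1 : U ⊆ {x | j x ≤ 0} := fun z (hz : j z < 0) => hz.le
      exact closure_minimal h1 (isClosed_le hjs.continuous continuous_const)
        (frontier_subset_closure hx)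
    · rw [hUo.frontier_eq] at hx
      exact not_lt.1 hx.2
  have hfg' : ∀ x ∈ frontier U, f x = -(B x + η * ‖x‖ ^ 2) + s := by
    intro x hx
    have h1 : A x + B x + 2 * η * ‖x‖ ^ 2 - 2 * s = 0 := hfg x hx
    simp only [hf]
    linarith
  have hdisj : ∀ x ∈ frontier U, x ∉ frontier Ω := fun x hx hx' => by
    rw [hUo.frontier_eq] at hx
    exact hx.2 (hΩU (frontier_subset_closure hx'))
  have hBSC : BoundedSlope U f (K + 1 : ℝ≥0) := by
    intro y hy
    obtain ⟨ζ, hζ, hζs⟩ := exists_slope_of_convexOn hAc hAd hAL hη0.le (hUR y hy)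
    obtain ⟨ξ, hξ, hξs⟩ := exists_slope_of_convexOn hBc hBd hBL hη0.le (hUR y hy)
    push_cast at hζ hξ ⊢
    refine ⟨ζ, -ξ, by linarith, by rw [norm_neg]; linarith, fun x hx => ⟨?_, ?_⟩⟩
    · simp only [hf]
      linarith [hζs x]
    · rw [hfg' x hx, hfg' y hy, inner_neg_left]
      linarith [hξs x]
  have hcross : ∀ x ∈ frontier U, ∀ y ∈ frontier Ω, |f x - φ y| ≤ (K + 1) * dist x y := by
    intro x hx y hy
    have h1 := hFL.le_add_mul x y
    have h2 := hGL.le_add_mul x y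
    push_cast at h1 h2
    rw [hFφ y hy] at h1
    rw [hGφ y hy] at h2
    have h3 := (abs_le.1 (hAF x)).2
    have h4 := (abs_le.1 (hBG x)).2
    have h5 := hηM x (hUR x hx)
    have h6 : (0 : ℝ) ≤ dist x y := dist_nonneg
    rw [abs_le]
    constructor
    · rw [hfg' x hx]
      linarith
    · simp only [hf]
      linarith
  classical
  have hLip : LipschitzOnWith (K + 1) (fun x => if x ∈ frontier Ω then φ x else f x)
      (frontier Ω ∪ frontier U) := by
    refine LipschitzOnWith.of_dist_le_mul fun x hx y hy => ?_
    simp only [Real.dist_eq]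
    push_cast
    rcases hx with hx | hx <;> rcases hy with hy | hy
    · rw [if_pos hx, if_pos hy]
      have h1 := h.lipschitzOnWith.dist_le_mul x hx y hy
      rw [Real.dist_eq] at h1
      linarith [dist_nonneg (x := x) (y := y)]
    · rw [if_pos hx, if_neg (hdisj y hy), abs_sub_comm, dist_comm]
      exact hcross y hy x hx
    · rw [if_neg (hdisj x hx), if_pos hy]
      exact hcross x hx y hy
    · rw [if_neg (hdisj x hx), if_neg (hdisj y hy)]
      simpa [Real.dist_eq] using hBSC.lipschitzOnWith.dist_le_mul x hx y hy
  obtain ⟨ψ, hψ, hψe⟩ := hLip.extend_real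
  have hψU : ∀ x ∈ frontier U, ψ x = f x := fun x hx => by
    rw [← hψe (Or.inr hx)]
    exact if_neg (hdisj x hx)
  refine ⟨U, ψ, ?_, hΩU, hUε, hψ, ⟨f, hfs, hψU⟩, ?_, fun x hx => ?_⟩
  · refine smoothUniformlyConvexDomain_setOf_lt_zero (c := 2 * η) (by positivity) hjs ?_ hUb
    refine ((hAc.add hBc).add (convexOn_const (-(2 * s)) convex_univ)).congr fun x _ => ?_
    simp only [hj, Pi.add_apply]
    ring
  · intro y hy
    obtain ⟨ζ, ξ, hζ, hξ, hyx⟩ := hBSC y hy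
    push_cast at hζ hξ
    refine ⟨ζ, ξ, by linarith, by linarith, fun x hx => ?_⟩
    rw [hψU x hx, hψU y hy]
    exact hyx x hx
  · rw [← hψe (Or.inl hx)]
    exact if_pos hx

theorem tendsto_volume_diff_of_subset_thickening {Ω : Set (EuclideanSpace ℝ (Fin N))}
    (hΩo : IsOpen Ω) (hΩb : Bornology.IsBounded Ω) (hΩc : Convex ℝ Ω)
    {U : ℕ → Set (EuclideanSpace ℝ (Fin N))} {ε : ℕ → ℝ} (hε : ∀ k, 0 < ε k)
    (hε0 : Tendsto ε atTop (𝓝 0)) (hU : ∀ k, U k ⊆ Metric.thickening (ε k) Ω) :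
    Tendsto (fun k => volume (U k \ Ω)) atTop (𝓝 0) := by
  have hfin : volume Ω ≠ ∞ := hΩb.measure_lt_top.ne
  have hcl : volume (closure Ω) = volume Ω := by
    refine measure_congr ?_
    rw [closure_eq_self_union_frontier]
    exact union_ae_eq_left_of_ae_eq_empty (ae_eq_empty.2
      (hΩc.addHaar_frontier volume))
  have h1 : Tendsto (fun k => volume (Metric.thickening (ε k) Ω)) atTop (𝓝 (volume Ω)) := by
    rw [← hcl]
    exact (tendsto_measure_thickening ⟨1, one_pos, hΩb.thickening.measure_lt_top.ne⟩).comp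
      (tendsto_nhdsWithin_iff.2 ⟨hε0, Eventually.of_forall hε⟩)
  have h2 : Tendsto (fun k => volume (Metric.thickening (ε k) Ω) - volume Ω) atTop (𝓝 0) := by
    simpa using ENNReal.Tendsto.sub h1 (tendsto_const_nhds (x := volume Ω)) (Or.inl hfin)
  refine tendsto_of_tendsto_of_tendsto_of_le_of_le tendsto_const_nhds h2 (fun _ => zero_le)
    fun k => ?_
  dsimp only
  rw [← measure_sdiff (Metric.self_subset_thickening (hε k) Ω)
    hΩo.measurableSet.nullMeasurableSet hfin]
  exact measure_mono (Set.sdiff_subset_sdiff_left (hU k))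

end Approximation

/-- **Lemma 2.6.** Approximation of a bounded convex set `Ω` by smooth bounded uniformly
convex open sets `Ω_k ⊇ Ω`, together with `(K+1)`-Lipschitz functions `φ_k` equal to `φ`
on `∂Ω`, smooth on `∂Ω_k` and satisfying the bounded slope condition of rank `K+2`
there. -/
theorem approximation_of_convex_sets_bounded_slope
    {N : ℕ} (Ω : Set (EuclideanSpace ℝ (Fin N)))
    (φ : EuclideanSpace ℝ (Fin N) → ℝ) (K : ℝ) (hK : 0 ≤ K)
    (hΩo : IsOpen Ω) (hΩb : Bornology.IsBounded Ω) (hΩc : Convex ℝ Ω)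
    (hbsc : BoundedSlope Ω φ K) :
    ∃ βΩ : ℝ, 0 < βΩ ∧
    ∃ Ωk : ℕ → Set (EuclideanSpace ℝ (Fin N)),
    ∃ φk : ℕ → EuclideanSpace ℝ (Fin N) → ℝ,
      (∀ k, SmoothUniformlyConvexDomain (Ωk k)) ∧
      -- (i) `Ω ⋐ Ω_k`, diameter control, `|Ω_k \ Ω| → 0`, Hausdorff convergence
      (∀ k, closure Ω ⊆ Ωk k) ∧
      (∀ k : ℕ, 1 ≤ k → Metric.diam (Ωk k) ≤ Metric.diam Ω + 8 * βΩ / (k : ℝ)) ∧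
      Tendsto (fun k => volume (Ωk k \ Ω)) atTop (nhds 0) ∧
      (∀ δ : ℝ, 0 < δ → ∀ᶠ k in atTop,
        ∀ y ∈ frontier Ω, ∃ y' ∈ frontier (Ωk k), dist y y' < δ) ∧
      -- the `φ_k` are `(K+1)`-Lipschitz
      (∀ k, LipschitzWith (Real.toNNReal (K + 1)) (φk k)) ∧
      -- (ii) `φ_k` restricted to `∂Ω_k` is smooth and satisfies the BSC of rank `K+2`
      (∀ k, ∃ Ψ : EuclideanSpace ℝ (Fin N) → ℝ, ContDiff ℝ (⊤ : ℕ∞) Ψ ∧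
        ∀ x ∈ frontier (Ωk k), φk k x = Ψ x) ∧
      (∀ k, BoundedSlope (Ωk k) (φk k) (K + 2)) ∧
      -- (iii) `φ_k = φ` on `∂Ω`
      (∀ k, ∀ x ∈ frontier Ω, φk k x = φ x) := by
  lift K to ℝ≥0 using hK
  have hK1 : Real.toNNReal ((K : ℝ) + 1) = K + 1 := by
    rw [← NNReal.coe_one, ← NNReal.coe_add, Real.toNNReal_coe]
  refine ⟨1, one_pos, ?_⟩
  rcases Set.eq_empty_or_nonempty (frontier Ω) with he | hne
  · have hcl : closure Ω = Ω := by rw [closure_eq_self_union_frontier, he, Set.union_empty]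
    refine ⟨fun _ => Ω, fun _ _ => 0,
      fun _ => smoothUniformlyConvexDomain_of_frontier_eq_empty hΩb he, fun _ => hcl.subset,
      fun k _ => le_add_of_nonneg_right (by positivity), by simp, by simp [he],
      fun _ => LipschitzWith.const' 0, fun _ => ⟨fun _ => 0, contDiff_const, fun _ _ => rfl⟩,
      fun _ y hy => by simp [he] at hy, by simp [he]⟩
  have hneΩ : Ω.Nonempty := by
    obtain ⟨x, hx⟩ := hne
    exact closure_nonempty_iff.1 ⟨x, frontier_subset_closure hx⟩
  have hpos : ∀ k : ℕ, 0 < 1 / ((k : ℝ) + 1) := fun k => Nat.one_div_pos_of_nat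
  have hle : ∀ k : ℕ, 1 / ((k : ℝ) + 1) ≤ 1 := fun k => by
    rw [div_le_one (by positivity)]
    linarith [Nat.cast_nonneg (α := ℝ) k]
  choose U ψ hUs hΩU hUε hψL hψs hψb hψe using fun k : ℕ =>
    hbsc.exists_smoothUniformlyConvexDomain hΩo hΩb hΩc hne (hpos k) (hle k)
  refine ⟨U, ψ, hUs, hΩU, fun k hk => ?_, ?_, fun δ hδ => ?_, fun k => hK1 ▸ hψL k, hψs, hψb, hψe⟩
  · have hk' : (0 : ℝ) < k := by exact_mod_cast hk
    calc Metric.diam (U k) ≤ Metric.diam (Metric.thickening (1 / ((k : ℝ) + 1)) Ω) :=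
          Metric.diam_mono (hUε k) hΩb.thickening
      _ ≤ Metric.diam Ω + 2 * (1 / ((k : ℝ) + 1)) := Metric.diam_thickening_le Ω (hpos k).le
      _ ≤ Metric.diam Ω + 8 * 1 / (k : ℝ) := by
          rw [mul_one_div]
          gcongr
          · norm_num
          · linarith
  · exact tendsto_volume_diff_of_subset_thickening hΩo hΩb hΩc hpos
      tendsto_one_div_add_atTop_nhds_zero_nat hUε
  · filter_upwards [tendsto_one_div_add_atTop_nhds_zero_nat.eventually_lt_const hδ]
      with k hk y hy
    have hyΩ : y ∉ Ω := by
      rw [hΩo.frontier_eq] at hy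
      exact hy.2
    obtain ⟨y', hy', hyy'⟩ := exists_mem_frontier_dist_le hΩo hΩc hneΩ (hUs k).1 (hUs k).2.1
      (hUε k) (hΩU k (frontier_subset_closure hy)) hyΩ
    exact ⟨y', hy', hyy'.trans_lt hk⟩

end
end

section
/- Let F : ℝ^N → ℝ be Φ-uniformly convex outside the ball B_R. Then for every ξ, ξ' ∈ ℝ^N such that the segment [ξ, ξ'] does not intersect B_R and every ζ in the subdifferential ∂F(ξ), one has F(ξ') ≥ F(ξ) + ⟨ζ, ξ' − ξ⟩ + (1/2)·Φ(|ξ| + |ξ'|)·|ξ − ξ'|². -/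
open MeasureTheory Filter
open scoped InnerProductSpace RealInnerProductSpace ENNReal NNReal Topology

noncomputable section

/-- `F` is `Φ`-uniformly convex outside the ball `B_R`. -/
def PhiUC {N : ℕ} (Φ : ℝ → ℝ) (R : ℝ) (F : EuclideanSpace ℝ (Fin N) → ℝ) : Prop :=
  ∀ z z' : EuclideanSpace ℝ (Fin N),
    (∀ w ∈ segment ℝ z z', R ≤ ‖w‖) →
    ∀ θ : ℝ, θ ∈ Set.Icc (0:ℝ) 1 →
      F (θ • z + (1 - θ) • z') ≤
        θ * F z + (1 - θ) * F z' - (1/2) * θ * (1 - θ) * Φ (‖z‖ + ‖z'‖) * ‖z - z'‖^2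

/-- The subdifferential of `F` at `ξ`. -/
def SubGrad {N : ℕ} (F : EuclideanSpace ℝ (Fin N) → ℝ) (ξ : EuclideanSpace ℝ (Fin N)) :
    Set (EuclideanSpace ℝ (Fin N)) :=
  {ζ | ∀ x, F ξ + ⟪ζ, x - ξ⟫ ≤ F x}

/-- If `F` is `Φ`-uniformly convex outside `B_R`, then for every `ξ, ξ'` whose segment
avoids `B_R` and every `ζ ∈ ∂F(ξ)`,
`F(ξ') ≥ F(ξ) + ⟨ζ, ξ'−ξ⟩ + (1/2) Φ(|ξ|+|ξ'|) |ξ−ξ'|²`. -/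
theorem subgradient_inequality_of_PhiUC
    {N : ℕ} (F : EuclideanSpace ℝ (Fin N) → ℝ) (Φ : ℝ → ℝ) (R : ℝ)
    (hFc : ConvexOn ℝ Set.univ F)
    (hFuc : PhiUC Φ R F)
    (ξ ξ' : EuclideanSpace ℝ (Fin N))
    (hseg : ∀ w ∈ segment ℝ ξ ξ', R ≤ ‖w‖)
    (ζ : EuclideanSpace ℝ (Fin N)) (hζ : ζ ∈ SubGrad F ξ) :
    F ξ + ⟪ζ, ξ' - ξ⟫ + (1/2) * Φ (‖ξ‖ + ‖ξ'‖) * ‖ξ - ξ'‖^2 ≤ F ξ' := by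
  set C : ℝ := (1/2) * Φ (‖ξ‖ + ‖ξ'‖) * ‖ξ - ξ'‖^2 with hC
  have key : ∀ t ∈ Set.Ioo (0:ℝ) 1, F ξ + ⟪ζ, ξ' - ξ⟫ + (1 - t) * C ≤ F ξ' := by
    rintro t ⟨ht0, ht1⟩
    have hupper := hFuc ξ ξ' hseg (1 - t) ⟨by linarith, by linarith⟩
    have hlower := hζ ((1 - t) • ξ + (1 - (1 - t)) • ξ')
    have hdir : (1 - t) • ξ + (1 - (1 - t)) • ξ' - ξ = t • (ξ' - ξ) := by module
    rw [hdir, real_inner_smul_right] at hlower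
    refine le_of_mul_le_mul_left ?_ ht0
    rw [hC]
    linarith
  have hlim : Tendsto (fun t : ℝ => F ξ + ⟪ζ, ξ' - ξ⟫ + (1 - t) * C) (𝓝[>] 0)
      (𝓝 (F ξ + ⟪ζ, ξ' - ξ⟫ + C)) := by
    have hcont : Continuous fun t : ℝ => F ξ + ⟪ζ, ξ' - ξ⟫ + (1 - t) * C := by fun_prop
    simpa using (hcont.tendsto 0).mono_left nhdsWithin_le_nhds
  refine le_of_tendsto hlim ?_
  filter_upwards [Ioo_mem_nhdsGT (zero_lt_one' ℝ)] with t ht using key t ht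

end
end

section
/- Let F : ℝ^N → ℝ be a continuous function which is Φ-uniformly convex outside the ball B_R, where Φ : (0,∞) → (0,∞) is continuous and satisfies lim_{t→∞} t·Φ(t) = +∞. Then F is superlinear, i.e. lim_{|ξ|→∞} F(ξ)/|ξ| = +∞. -/
open MeasureTheory Filter
open scoped InnerProductSpace RealInnerProductSpace ENNReal NNReal Topology

noncomputable section

/-- **Lemma 3.2.** A continuous `F` which is `Φ`-uniformly convex outside `B_R`, where
`Φ : (0,∞) → (0,∞)` is continuous with `t·Φ(t) → +∞`, is superlinear:
`F(ξ)/|ξ| → +∞` as `|ξ| → ∞`. -/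
theorem superlinear_of_PhiUC
    {N : ℕ} (F : EuclideanSpace ℝ (Fin N) → ℝ) (Φ : ℝ → ℝ) (R : ℝ)
    (hFcont : Continuous F)
    (hR : 0 < R)
    (hΦpos : ∀ t, 0 < t → 0 < Φ t) (hΦcont : ContinuousOn Φ (Set.Ioi 0))
    (hΦsuper : Tendsto (fun t => t * Φ t) atTop atTop)
    (hFuc : PhiUC Φ R F) :
    Tendsto (fun ξ : EuclideanSpace ℝ (Fin N) => F ξ / ‖ξ‖) (comap norm atTop) atTop := by
  obtain ⟨C, hC⟩ := (isCompact_closedBall (0 : EuclideanSpace ℝ (Fin N)) (2 * R)).exists_bound_of_continuousOn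
    hFcont.continuousOn
  have hC0 : 0 ≤ C := (norm_nonneg _).trans (hC 0 (by simp [hR.le]))
  rw [tendsto_atTop]
  intro A
  obtain ⟨T, hT⟩ := eventually_atTop.1
    (hΦsuper.eventually_ge_atTop (32 * (|A| + 2 * C / R)))
  have hlarge : ∀ᶠ t : ℝ in atTop, T ≤ t ∧ 3 * R ≤ t :=
    (eventually_ge_atTop T).and (eventually_ge_atTop (3 * R))
  filter_upwards [hlarge.comap norm] with ξ hξ
  obtain ⟨hTξ, hRξ⟩ := hξ
  set t := ‖ξ‖ with ht
  have ht0 : 0 < t := by linarith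
  have htR : 0 < t - R := by linarith
  have hz' : ‖(R / t) • ξ‖ = R := by
    rw [norm_smul, Real.norm_of_nonneg (by positivity), ← ht]
    field_simp
  have hdist : ‖ξ - (R / t) • ξ‖ = t - R := by
    have h1 : ξ - (R / t) • ξ = ((t - R) / t) • ξ := by
      rw [sub_div, div_self ht0.ne', sub_smul, one_smul]
    rw [h1, norm_smul, Real.norm_of_nonneg (by positivity), ← ht]
    field_simp
  have hseg : ∀ w ∈ segment ℝ ξ ((R / t) • ξ), R ≤ ‖w‖ := by
    rintro w ⟨a, b, ha, hb, hab, rfl⟩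
    rw [smul_smul, ← add_smul, norm_smul, Real.norm_of_nonneg (by positivity), ← ht]
    have h1 : (a + b * (R / t)) * t = a * t + b * R := by field_simp
    rw [h1]
    obtain rfl : b = 1 - a := by linarith
    nlinarith
  obtain ⟨θ, hθ⟩ : ∃ θ, θ = R / (t - R) := ⟨_, rfl⟩
  have hθR : θ * (t - R) = R := by rw [hθ]; field_simp
  have hθ0 : 0 < θ := hθ ▸ div_pos hR htR
  have hθ2 : θ ≤ 1 / 2 := by rw [hθ, div_le_iff₀ htR]; linarith
  have huc := hFuc ξ ((R / t) • ξ) hseg θ ⟨hθ0.le, by linarith⟩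
  rw [hz', hdist, ← ht] at huc
  have hp : ‖θ • ξ + (1 - θ) • (R / t) • ξ‖ ≤ 2 * R := by
    refine (norm_add_le _ _).trans ?_
    rw [norm_smul, norm_smul (1 - θ), hz', Real.norm_of_nonneg hθ0.le,
      Real.norm_of_nonneg (by linarith), ← ht]
    linarith
  have hFp := (abs_le.1 (hC _ (mem_closedBall_zero_iff.2 hp))).1
  have hFz' := (abs_le.1 (hC _ (mem_closedBall_zero_iff.2 (by rw [hz']; linarith)))).2
  have hM := hT (t + R) (by linarith)
  have hΦ := hΦpos (t + R) (by linarith)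
  set P := Φ (t + R)
  have hsq : (t + R) * t / 8 ≤ (t - R) ^ 2 := by nlinarith
  have hgain : (|A| + 2 * C / R) * t ≤ 1 / 4 * (P * (t - R) ^ 2) := by
    have h1 := mul_le_mul_of_nonneg_left hsq hΦ.le
    have h2 := mul_le_mul_of_nonneg_right hM ht0.le
    linarith
  have hconv : 1 / 4 * (P * (t - R) ^ 2) * θ ≤ 1 / 2 * θ * (1 - θ) * P * (t - R) ^ 2 := by
    have h1 : 0 ≤ P * (t - R) ^ 2 * θ := by positivity
    nlinarith
  have hlow : (1 - θ) * F ((R / t) • ξ) ≤ C := by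
    nlinarith
  have hloss : 2 * C ≤ 2 * C / R * t * θ := by
    have h1 : 2 * C = 2 * C / R * (θ * (t - R)) := by rw [hθR]; field_simp
    have h2 : 0 ≤ 2 * C / R * (θ * R) := by positivity
    linarith
  have hmain : |A| * t * θ ≤ F ξ * θ := by
    have h1 := mul_le_mul_of_nonneg_right hgain hθ0.le
    linarith
  rw [le_div_iff₀ ht0]
  have h1 := le_of_mul_le_mul_right hmain hθ0
  nlinarith [le_abs_self A]

end
end

section
/- Let F : ℝ^N → ℝ be a convex function which is Φ-uniformly convex outside the ball B_R, and let {ρ_ε}_{ε>0} be standard mollifiers with ρ_ε ∈ C_0^∞(B_ε). Then for every ε > 0, every R' > R + ε, every ξ ∈ B_{R'} \ B_{R+ε} and every η ∈ ℝ^N, one has ⟨∇²(F*ρ_ε)(ξ)η, η⟩ ≥ (min_{t ∈ [2R, 2(R'+ε)]} Φ(t))·|η|². -/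
open MeasureTheory Filter
open scoped InnerProductSpace RealInnerProductSpace ENNReal NNReal Topology

noncomputable section

open scoped Convolution

/-- `ρ` is a family of standard mollifiers: `ρ_ε ∈ C_0^∞(B_ε)`, `ρ_ε ≥ 0`, `∫ ρ_ε = 1`. -/
def StdMollifier {N : ℕ} (ρ : ℝ → EuclideanSpace ℝ (Fin N) → ℝ) : Prop :=
  ∀ ε : ℝ, 0 < ε →
    ContDiff ℝ (⊤ : ℕ∞) (ρ ε) ∧ (∀ x, 0 ≤ ρ ε x) ∧
    tsupport (ρ ε) ⊆ Metric.ball 0 ε ∧ (∫ x, ρ ε x) = 1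

/-- A quadratic lower bound on the symmetric second difference of a `C²` function bounds its second
derivative from below. -/
theorem le_iteratedFDeriv_two_of_symm_diff {E : Type*} [NormedAddCommGroup E] [NormedSpace ℝ E]
    {G : E → ℝ} (hG : ContDiff ℝ 2 G) {ξ η : E} {c : ℝ}
    (h : ∀ᶠ t : ℝ in 𝓝 0, c * t ^ 2 ≤ G (ξ + t • η) + G (ξ - t • η) - 2 * G ξ) :
    c ≤ iteratedFDeriv ℝ 2 G ξ ![η, η] := by
  rw [iteratedFDeriv_two_apply]
  simp only [Matrix.cons_val_zero, Matrix.cons_val_one]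
  set D := fderiv ℝ (fderiv ℝ G) ξ η η with hD
  by_contra! hlt
  have hplus : ∀ t : ℝ, HasDerivAt (fun t : ℝ => ξ + t • η) η t := fun t => by
    simpa using ((hasDerivAt_id t).smul_const η).const_add ξ
  have hminus : ∀ t : ℝ, HasDerivAt (fun t : ℝ => ξ - t • η) (-η) t := fun t => by
    simpa using ((hasDerivAt_id t).smul_const η).const_sub ξ
  have hdG : Differentiable ℝ G := hG.differentiable (by norm_num)
  have hdG' : Differentiable ℝ (fderiv ℝ G) :=
    (hG.fderiv_right (m := 1) (by norm_num)).differentiable (by norm_num)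
  let f : ℝ → ℝ := fun t => G (ξ + t • η) + G (ξ - t • η) - 2 * G ξ - c * t ^ 2
  have hf : ∀ t, HasDerivAt f
      (fderiv ℝ G (ξ + t • η) η + fderiv ℝ G (ξ - t • η) (-η) - c * (2 * t)) t := fun t => by
    have h1 := (hdG (ξ + t • η)).hasFDerivAt.comp_hasDerivAt t (hplus t)
    have h2 := (hdG (ξ - t • η)).hasFDerivAt.comp_hasDerivAt t (hminus t)
    have h3 := ((hasDerivAt_pow 2 t).const_mul c)
    refine (((h1.fun_add h2).sub_const (2 * G ξ)).fun_sub h3).congr_deriv ?_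
    simp
  have hf' : deriv f = fun t =>
      fderiv ℝ G (ξ + t • η) η + fderiv ℝ G (ξ - t • η) (-η) - c * (2 * t) :=
    funext fun t => (hf t).deriv
  have hff : HasDerivAt (deriv f) (2 * D - 2 * c) 0 := by
    rw [hf']
    have h1 : HasDerivAt (fun t : ℝ => fderiv ℝ G (ξ + t • η)) (fderiv ℝ (fderiv ℝ G) ξ η) 0 :=
      (hdG' ξ).hasFDerivAt.comp_hasDerivAt_of_eq (0 : ℝ) (hplus 0) (by simp)
    have h2 : HasDerivAt (fun t : ℝ => fderiv ℝ G (ξ - t • η)) (fderiv ℝ (fderiv ℝ G) ξ (-η)) 0 :=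
      (hdG' ξ).hasFDerivAt.comp_hasDerivAt_of_eq (0 : ℝ) (hminus 0) (by simp)
    have h3 := ((hasDerivAt_id' (0 : ℝ)).const_mul 2).const_mul c
    have h4 := h1.clm_apply (hasDerivAt_const (0 : ℝ) η)
    have h5 := h2.clm_apply (hasDerivAt_const (0 : ℝ) (-η))
    refine ((h4.fun_add h5).fun_sub h3).congr_deriv ?_
    simp only [map_neg, map_zero, neg_apply, neg_neg, add_zero, mul_one, ← hD]
    ring
  have hmax : IsLocalMax f 0 := isLocalMax_of_deriv_deriv_neg (by rw [hff.deriv]; linarith)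
    (by simp [hf']) (hf 0).continuousAt
  have hf0 : f 0 = 0 := by simp [f]; ring
  have hzero : f =ᶠ[𝓝 0] fun _ => 0 := by
    filter_upwards [hmax, h] with t h1 h2
    simp only [f] at h1 h2 hf0 ⊢
    linarith
  have h0 : deriv (deriv f) 0 = 0 := by
    rw [hzero.deriv.deriv_eq]
    simp
  rw [hff.deriv] at h0
  linarith

/-- Symmetric second differences of a `Φ`-uniformly convex function around a point `x` with
`B(x, δ)` lying in a spherical shell outside `B_R`. -/
theorem PhiUC.symm_diff_lower_bound {N : ℕ} {Φ : ℝ → ℝ} {R S : ℝ}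
    {F : EuclideanSpace ℝ (Fin N) → ℝ} (hF : PhiUC Φ R F)
    (hΦ : BddBelow (Φ '' Set.Icc (2 * R) (2 * S))) {x v : EuclideanSpace ℝ (Fin N)}
    (hlow : R + ‖v‖ ≤ ‖x‖) (hupp : ‖x‖ + ‖v‖ ≤ S) :
    sInf (Φ '' Set.Icc (2 * R) (2 * S)) * ‖v‖ ^ 2 ≤ F (x + v) + F (x - v) - 2 * F x := by
  have hball : ∀ w ∈ Metric.closedBall x ‖v‖, R ≤ ‖w‖ := fun w hw => by
    have h1 := norm_sub_norm_le x w
    rw [mem_closedBall_iff_norm'] at hw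
    linarith
  have hp : x + v ∈ Metric.closedBall x ‖v‖ := by simp
  have hm : x - v ∈ Metric.closedBall x ‖v‖ := by simp
  have key := hF (x + v) (x - v)
    (fun w hw => hball w ((convex_closedBall x ‖v‖).segment_subset hp hm hw)) (1 / 2)
    (by norm_num)
  have hmid : (1 / 2 : ℝ) • (x + v) + (1 - 1 / 2 : ℝ) • (x - v) = x := by module
  have hdiff : x + v - (x - v) = (2 : ℝ) • v := by module
  rw [hmid, hdiff, norm_smul] at key
  have hmem : ‖x + v‖ + ‖x - v‖ ∈ Set.Icc (2 * R) (2 * S) := by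
    have h1 := hball _ hp
    have h2 := hball _ hm
    have h3 := norm_add_le x v
    have h4 := norm_sub_le x v
    constructor <;> linarith
  have hΦle := mul_le_mul_of_nonneg_right (csInf_le hΦ (Set.mem_image_of_mem Φ hmem))
    (sq_nonneg ‖v‖)
  norm_num at key
  linarith

/-- The second difference of a mollification is bounded below by any constant bounding those of
the original function from below on the support of the mollifier. -/
theorem convolution_symm_diff_lower_bound {E : Type*} [NormedAddCommGroup E] [NormedSpace ℝ E]
    [FiniteDimensional ℝ E] [MeasurableSpace E] [BorelSpace E] {μ : Measure E}
    [μ.IsAddHaarMeasure] {F g : E → ℝ} (hF : Continuous F) (hg : Continuous g)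
    (hgc : HasCompactSupport g) (hg0 : ∀ x, 0 ≤ g x) (hg1 : ∫ x, g x ∂μ = 1) {ξ v : E} {c : ℝ}
    (h : ∀ y ∈ tsupport g, c ≤ F (ξ - y + v) + F (ξ - y - v) - 2 * F (ξ - y)) :
    c ≤ (F ⋆[ContinuousLinearMap.lsmul ℝ ℝ, μ] g) (ξ + v)
      + (F ⋆[ContinuousLinearMap.lsmul ℝ ℝ, μ] g) (ξ - v)
      - 2 * (F ⋆[ContinuousLinearMap.lsmul ℝ ℝ, μ] g) ξ := by
  have hint : ∀ x, Integrable (fun y => F (x - y) * g y) μ := fun x =>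
    (Continuous.integrable_of_hasCompactSupport (by fun_prop) hgc.mul_left)
  have hgi : Integrable g μ := hg.integrable_of_hasCompactSupport hgc
  simp only [convolution_eq_swap, ContinuousLinearMap.lsmul_apply, smul_eq_mul]
  rw [← integral_add (hint _) (hint _), ← integral_const_mul,
    ← integral_sub ((hint _).fun_add (hint _)) ((hint _).const_mul 2)]
  calc c = ∫ y, c * g y ∂μ := by rw [integral_const_mul, hg1, mul_one]
    _ ≤ _ := by
      refine integral_mono (hgi.const_mul c)
        (((hint _).fun_add (hint _)).sub ((hint _).const_mul 2)) fun y => ?_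
      by_cases hy : y ∈ tsupport g
      · have h1 := mul_le_mul_of_nonneg_right (h y hy) (hg0 y)
        have e1 : ξ + v - y = ξ - y + v := by abel
        have e2 : ξ - v - y = ξ - y - v := by abel
        simp only [e1, e2]
        linarith
      · simp [image_eq_zero_of_notMem_tsupport hy]

/-- **Lemma A.1 (i).** If `F` is convex and `Φ`-uniformly convex outside `B_R`, then for
every `ε > 0`, `R' > R + ε`, `ξ ∈ B_{R'} \ B_{R+ε}` and `η ∈ ℝ^N`,
`⟨∇²(F∗ρ_ε)(ξ) η, η⟩ ≥ (min_{t∈[2R, 2(R'+ε)]} Φ(t)) |η|²`. -/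
theorem mollification_second_derivative_lower_bound
    {N : ℕ} (F : EuclideanSpace ℝ (Fin N) → ℝ) (Φ : ℝ → ℝ) (R : ℝ)
    (ρ : ℝ → EuclideanSpace ℝ (Fin N) → ℝ)
    (hρ : StdMollifier ρ)
    (hR : 0 < R)
    (hΦpos : ∀ t, 0 < t → 0 < Φ t) (hΦcont : ContinuousOn Φ (Set.Ioi 0))
    (hFc : ConvexOn ℝ Set.univ F)
    (hFuc : PhiUC Φ R F) :
    ∀ ε : ℝ, 0 < ε → ∀ R' : ℝ, R + ε < R' →
      ∀ ξ ∈ Metric.ball (0 : EuclideanSpace ℝ (Fin N)) R' \ Metric.ball 0 (R + ε),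
        ∀ η : EuclideanSpace ℝ (Fin N),
          (sInf (Φ '' Set.Icc (2 * R) (2 * (R' + ε)))) * ‖η‖^2 ≤
            iteratedFDeriv ℝ 2 (F ⋆[ContinuousLinearMap.lsmul ℝ ℝ, volume] ρ ε) ξ ![η, η] := by
  intro ε hε R' hR' ξ hξ η
  obtain ⟨hsmooth, hnonneg, hsupp, hone⟩ := hρ ε hε
  have hF : Continuous F := hFc.locallyLipschitz.continuous
  have hcs : HasCompactSupport (ρ ε) :=
    (isCompact_closedBall (0 : EuclideanSpace ℝ (Fin N)) ε).of_isClosed_subset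
      (isClosed_tsupport _) (hsupp.trans Metric.ball_subset_closedBall)
  have hC2 : ContDiff ℝ 2 (F ⋆[ContinuousLinearMap.lsmul ℝ ℝ, volume] ρ ε) :=
    hcs.contDiff_convolution_right (n := 2) _ hF.locallyIntegrable
      (hsmooth.of_le (by exact_mod_cast le_top))
  obtain ⟨r, hr, hsub⟩ := exists_lt_subset_ball (isClosed_tsupport (ρ ε)) hsupp
  have hbdd : BddBelow (Φ '' Set.Icc (2 * R) (2 * (R' + ε))) := by
    refine ⟨0, ?_⟩
    rintro _ ⟨t, ht, rfl⟩
    exact (hΦpos t (by linarith [ht.1])).le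
  simp only [Set.mem_sdiff, mem_ball_zero_iff, not_lt] at hξ
  refine le_iteratedFDeriv_two_of_symm_diff hC2 ?_
  have hsmall : ∀ᶠ t : ℝ in 𝓝 0, ‖t • η‖ < ε - r := by
    have hc : Tendsto (fun t : ℝ => ‖t • η‖) (𝓝 0) (𝓝 0) := by
      have : Continuous fun t : ℝ => ‖t • η‖ := by fun_prop
      simpa using this.tendsto 0
    exact hc.eventually_lt_const (by linarith)
  filter_upwards [hsmall] with t ht
  refine convolution_symm_diff_lower_bound hF hsmooth.continuous hcs hnonneg hone fun y hy => ?_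
  have hy' : ‖y‖ < r := by simpa using hsub hy
  have hlow := norm_sub_norm_le ξ y
  have hupp := norm_sub_le ξ y
  have key := hFuc.symm_diff_lower_bound hbdd (x := ξ - y) (v := t • η)
    (by linarith) (by linarith)
  rw [norm_smul, mul_pow, Real.norm_eq_abs, sq_abs] at key
  linarith

end
end

section
/- Let F : ℝ^N → ℝ be a convex function and {ρ_ε}_{ε>0} standard mollifiers with ρ_ε ∈ C_0^∞(B_ε). Assume there exist μ > 0 and R > 0 such that for every ε > 0, every x ∈ ℝ^N with |x| ≥ R + ε and every η ∈ ℝ^N, one has ⟨∇²(F*ρ_ε)(x)η, η⟩ ≥ μ|η|². Then F is μ-uniformly convex outside B_R. -/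
open MeasureTheory Filter
open scoped InnerProductSpace RealInnerProductSpace ENNReal NNReal Topology

noncomputable section

open scoped Convolution

/-- A `C²` function whose Hessian is bounded below by `μ` in the direction `z - z'` along the
segment `[z, z']` satisfies the `μ`-uniform convexity inequality on that segment. -/
theorem le_sub_of_le_iteratedFDeriv_two {E : Type*} [NormedAddCommGroup E] [NormedSpace ℝ E]
    {G : E → ℝ} {μ : ℝ} {z z' : E} (hG : ContDiff ℝ 2 G)
    (hb : ∀ w ∈ segment ℝ z z',
      μ * ‖z - z'‖ ^ 2 ≤ iteratedFDeriv ℝ 2 G w ![z - z', z - z'])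
    {θ : ℝ} (hθ : θ ∈ Set.Icc (0 : ℝ) 1) :
    G (θ • z + (1 - θ) • z') ≤
      θ * G z + (1 - θ) * G z' - (1 / 2) * θ * (1 - θ) * μ * ‖z - z'‖ ^ 2 := by
  set v := z - z' with hv
  set c := μ * ‖v‖ ^ 2 with hc
  have hline : ∀ s : ℝ, HasDerivAt (fun s : ℝ => z' + s • v) v s := fun s => by
    simpa using ((hasDerivAt_id s).smul_const v).const_add z'
  have hdG : Differentiable ℝ G := hG.differentiable (by norm_num)
  have hdG' : Differentiable ℝ (fderiv ℝ G) :=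
    (hG.fderiv_right (m := 1) (by norm_num)).differentiable (by norm_num)
  have h1 : ∀ s : ℝ, HasDerivAt (fun s : ℝ => G (z' + s • v) - c / 2 * s ^ 2)
      (fderiv ℝ G (z' + s • v) v - c * s) s := fun s => by
    have h := ((hdG (z' + s • v)).hasFDerivAt.comp_hasDerivAt s (hline s)).sub
      (((hasDerivAt_id s).pow 2).const_mul (c / 2))
    refine h.congr_deriv ?_
    simp
    ring
  have h2 : ∀ s : ℝ, HasDerivAt (fun s : ℝ => fderiv ℝ G (z' + s • v) v - c * s)
      (fderiv ℝ (fderiv ℝ G) (z' + s • v) v v - c) s := fun s => by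
    have h : HasDerivAt (fun s : ℝ => fderiv ℝ G (z' + s • v))
        (fderiv ℝ (fderiv ℝ G) (z' + s • v) v) s :=
      (hdG' (z' + s • v)).hasFDerivAt.comp_hasDerivAt s (hline s)
    have h' : HasDerivAt (fun s : ℝ => fderiv ℝ G (z' + s • v) v)
        (fderiv ℝ (fderiv ℝ G) (z' + s • v) v v) s := by
      simpa using h.clm_apply (hasDerivAt_const s v)
    exact (h'.sub ((hasDerivAt_id s).const_mul c)).congr_deriv (by rw [mul_one])
  have hconv : ConvexOn ℝ (Set.Icc (0 : ℝ) 1) (fun s : ℝ => G (z' + s • v) - c / 2 * s ^ 2) := by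
    refine convexOn_of_hasDerivWithinAt2_nonneg (convex_Icc 0 1)
      (fun s _ => (h1 s).continuousAt.continuousWithinAt)
      (fun s _ => (h1 s).hasDerivWithinAt) (fun s _ => (h2 s).hasDerivWithinAt) ?_
    intro s hs
    have hs' := interior_subset hs
    have hw : z' + s • v ∈ segment ℝ z z' :=
      ⟨s, 1 - s, hs'.1, by linarith [hs'.2], by ring, by rw [hv]; module⟩
    have := hb _ hw
    rw [iteratedFDeriv_two_apply] at this
    simpa using this
  have key := hconv.2 (Set.right_mem_Icc.2 zero_le_one) (Set.left_mem_Icc.2 zero_le_one)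
    hθ.1 (sub_nonneg.2 hθ.2) (by ring)
  have e1 : z' + θ • v = θ • z + (1 - θ) • z' := by rw [hv]; module
  have e2 : z' + v = z := by rw [hv]; module
  simp only [smul_eq_mul, mul_one, mul_zero, add_zero, one_smul, zero_smul, e1, e2] at key
  have : 1 / 2 * θ * (1 - θ) * μ * ‖v‖ ^ 2 = c / 2 * (θ - θ ^ 2) := by rw [hc]; ring
  rw [this]
  nlinarith [key]

/-- Mollifications of a continuous function converge along convergent sequences of points. -/
theorem StdMollifier.tendsto_convolution {N : ℕ} {ρ : ℝ → EuclideanSpace ℝ (Fin N) → ℝ}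
    (hρ : StdMollifier ρ) {F : EuclideanSpace ℝ (Fin N) → ℝ} (hF : Continuous F)
    {k : ℝ → EuclideanSpace ℝ (Fin N)} {x : EuclideanSpace ℝ (Fin N)}
    (hk : Tendsto k (𝓝[>] 0) (𝓝 x)) :
    Tendsto (fun ε => (F ⋆[ContinuousLinearMap.lsmul ℝ ℝ, volume] ρ ε) (k ε))
      (𝓝[>] 0) (𝓝 (F x)) := by
  have hflip : ∀ ε, (F ⋆[ContinuousLinearMap.lsmul ℝ ℝ, volume] ρ ε) =
      (ρ ε ⋆[ContinuousLinearMap.lsmul ℝ ℝ, volume] F) := fun ε => by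
    rw [← convolution_flip]
    congr 1
    ext
    simp
  simp_rw [hflip]
  have hpos : ∀ᶠ ε : ℝ in 𝓝[>] 0, 0 < ε := self_mem_nhdsWithin
  refine convolution_tendsto_right (hpos.mono fun ε hε => (hρ ε hε).2.1)
    (hpos.mono fun ε hε => (hρ ε hε).2.2.2) ?_
    (Eventually.of_forall fun _ => hF.aestronglyMeasurable)
    ((hF.tendsto x).comp tendsto_snd) hk
  rw [tendsto_smallSets_iff]
  intro t ht
  obtain ⟨δ, hδ, hδt⟩ := Metric.mem_nhds_iff.1 ht
  filter_upwards [Ioo_mem_nhdsGT hδ] with ε hε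
  exact (subset_tsupport _).trans
    ((hρ ε hε.1).2.2.1.trans ((Metric.ball_subset_ball hε.2.le).trans hδt))

/-- The mollification of a continuous function is smooth. -/
theorem StdMollifier.contDiff_convolution {N : ℕ} {ρ : ℝ → EuclideanSpace ℝ (Fin N) → ℝ}
    (hρ : StdMollifier ρ) {F : EuclideanSpace ℝ (Fin N) → ℝ} (hF : Continuous F)
    {ε : ℝ} (hε : 0 < ε) :
    ContDiff ℝ (⊤ : ℕ∞) (F ⋆[ContinuousLinearMap.lsmul ℝ ℝ, volume] ρ ε) := by
  obtain ⟨hsmooth, -, hsupp, -⟩ := hρ ε hε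
  have hcs : HasCompactSupport (ρ ε) :=
    (isCompact_closedBall (0 : EuclideanSpace ℝ (Fin N)) ε).of_isClosed_subset
      (isClosed_tsupport _) (hsupp.trans Metric.ball_subset_closedBall)
  exact hcs.contDiff_convolution_right _ hF.locallyIntegrable hsmooth

/-- **Lemma A.1 (ii).** Let `F` be convex. If there are `μ > 0` and `R > 0` such that for
every `ε > 0`, every `|x| ≥ R + ε` and every `η`, `⟨∇²(F∗ρ_ε)(x) η, η⟩ ≥ μ|η|²`, then `F`
is `μ`-uniformly convex outside `B_R`. -/
theorem mu_uniformly_convex_of_mollified_bound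
    {N : ℕ} (F : EuclideanSpace ℝ (Fin N) → ℝ) (μ R : ℝ)
    (ρ : ℝ → EuclideanSpace ℝ (Fin N) → ℝ)
    (hρ : StdMollifier ρ)
    (hFc : ConvexOn ℝ Set.univ F)
    (hμ : 0 < μ) (hR : 0 < R)
    (hbound : ∀ ε : ℝ, 0 < ε → ∀ x : EuclideanSpace ℝ (Fin N), R + ε ≤ ‖x‖ →
      ∀ η : EuclideanSpace ℝ (Fin N),
        μ * ‖η‖^2 ≤
          iteratedFDeriv ℝ 2 (F ⋆[ContinuousLinearMap.lsmul ℝ ℝ, volume] ρ ε) x ![η, η]) :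
    PhiUC (fun _ => μ) R F := by
  have hF : Continuous F := hFc.locallyLipschitz.continuous
  intro z z' hseg θ hθ
  -- Dilating by `a ε = 1 + ε / R` moves the segment outside the ball of radius `R + ε`.
  set a : ℝ → ℝ := fun ε => 1 + ε / R with ha
  have hat : Tendsto a (𝓝[>] 0) (𝓝 1) := by
    have : Continuous a := by fun_prop
    simpa [ha] using (this.tendsto 0).mono_left nhdsWithin_le_nhds
  have hlim : ∀ w : EuclideanSpace ℝ (Fin N), Tendsto (fun ε => a ε • w) (𝓝[>] 0) (𝓝 w) :=
    fun w => by simpa using hat.smul_const w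
  have hconv := fun w => hρ.tendsto_convolution hF (hlim w)
  have hnorm : Tendsto (fun ε => ‖a ε • z - a ε • z'‖ ^ 2) (𝓝[>] 0) (𝓝 (‖z - z'‖ ^ 2)) :=
    ((hlim z).sub (hlim z')).norm.pow 2
  refine le_of_tendsto_of_tendsto (hconv (θ • z + (1 - θ) • z'))
    ((((hconv z).const_mul θ).add ((hconv z').const_mul (1 - θ))).sub
      (hnorm.const_mul ((1 / 2) * θ * (1 - θ) * μ))) ?_
  filter_upwards [self_mem_nhdsWithin] with ε (hε : 0 < ε)
  have hapos : 0 < a ε := by positivity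
  have hG := (hρ.contDiff_convolution hF hε).of_le (m := 2) (WithTop.coe_le_coe.2 le_top)
  have key := le_sub_of_le_iteratedFDeriv_two (μ := μ) (z := a ε • z) (z' := a ε • z') hG ?_ hθ
  · rwa [show a ε • (θ • z + (1 - θ) • z') = θ • a ε • z + (1 - θ) • a ε • z' by module]
  · rintro _ ⟨s, t, hs, ht, hst, rfl⟩
    refine hbound ε hε _ ?_ _
    rw [show s • a ε • z + t • a ε • z' = a ε • (s • z + t • z') by module, norm_smul,
      Real.norm_of_nonneg hapos.le]
    calc R + ε = a ε * R := by rw [ha]; field_simp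
      _ ≤ a ε * ‖s • z + t • z'‖ :=
        mul_le_mul_of_nonneg_left (hseg _ ⟨s, t, hs, ht, hst, rfl⟩) hapos.le

end
end

section
/- Let F : ℝ^N → ℝ be a convex function which is μ-uniformly convex outside the ball B_R = B_R(0) ⊂ ℝ^N. Then for every ξ, ξ' ∈ ℝ^N and every ζ in the subdifferential ∂F(ξ), one has F(ξ') ≥ F(ξ) + ⟨ζ, ξ' − ξ⟩ + (μ/4)·𝓗¹([ξ, ξ'] \ B_R)², where 𝓗¹ denotes the 1-dimensional Hausdorff measure and [ξ, ξ'] is the closed segment from ξ to ξ'. -/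
open MeasureTheory Filter
open scoped InnerProductSpace RealInnerProductSpace ENNReal NNReal Topology

noncomputable section

/-- A function that is monotone and satisfies the uniform convexity inequality on
`[s, t]` grows at least quadratically from `s` to `t`. -/
theorem add_sq_le_of_monotoneOn_of_uniformConvex {f : ℝ → ℝ} {c s t : ℝ} (hst : s ≤ t)
    (hmono : MonotoneOn f (Set.Icc s t))
    (huc : ∀ θ ∈ Set.Icc (0 : ℝ) 1,
      f (θ * t + (1 - θ) * s) ≤ θ * f t + (1 - θ) * f s - (1 / 2) * θ * (1 - θ) * c) :
    f s + c / 2 ≤ f t := by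
  have key : ∀ θ ∈ Set.Ioo (0 : ℝ) 1, f s + (1 - θ) * (c / 2) ≤ f t := by
    intro θ hθ
    have h1 := huc θ ⟨hθ.1.le, hθ.2.le⟩
    have h2 : f s ≤ f (θ * t + (1 - θ) * s) := by
      apply hmono ⟨le_rfl, hst⟩
      · constructor <;> nlinarith [hθ.1, hθ.2]
      · nlinarith [hθ.1, hθ.2]
    have h3 : θ * (f s + (1 - θ) * (c / 2)) ≤ θ * f t := by linarith
    exact le_of_mul_le_mul_left h3 hθ.1
  have hlim : Tendsto (fun θ : ℝ => f s + (1 - θ) * (c / 2)) (𝓝[>] 0) (𝓝 (f s + c / 2)) := by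
    have : Continuous (fun θ : ℝ => f s + (1 - θ) * (c / 2)) := by fun_prop
    simpa using (this.tendsto 0).mono_left nhdsWithin_le_nhds
  refine le_of_tendsto hlim ?_
  filter_upwards [Ioo_mem_nhdsGT (zero_lt_one' ℝ)] with θ hθ using key θ hθ

/-- An order-connected subset of `[0, 1]` is an interval, up to its endpoints. -/
theorem exists_endpoints_of_ordConnected {T : Set ℝ} (hT : T ⊆ Set.Icc 0 1)
    (hc : T.OrdConnected) :
    ∃ a b : ℝ, 0 ≤ a ∧ a ≤ b ∧ b ≤ 1 ∧ (∀ t ∈ T, a ≤ t ∧ t ≤ b) ∧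
      ∀ t, a < t → t < b → t ∈ T := by
  rcases T.eq_empty_or_nonempty with rfl | hne
  · exact ⟨1, 1, zero_le_one, le_rfl, le_rfl, by simp, fun t h1 h2 => absurd h1 h2.not_gt⟩
  · have hb : BddBelow T := ⟨0, fun t ht => (hT ht).1⟩
    have ha : BddAbove T := ⟨1, fun t ht => (hT ht).2⟩
    refine ⟨sInf T, sSup T, le_csInf hne fun t ht => (hT ht).1, csInf_le_csSup hne hb ha,
      csSup_le hne fun t ht => (hT ht).2, fun t ht => ⟨csInf_le hb ht, le_csSup ha ht⟩, ?_⟩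
    intro t h1 h2
    obtain ⟨x, hx, hxt⟩ := exists_lt_of_csInf_lt hne h1
    obtain ⟨y, hy, hty⟩ := exists_lt_of_lt_csSup hne h2
    exact hc.out hx hy ⟨hxt.le, hty.le⟩

/-- The image of two intervals under an affine path has one-dimensional Hausdorff measure at most
their total length times the speed. -/
theorem toReal_hausdorffMeasure_le {N : ℕ} {ξ d : EuclideanSpace ℝ (Fin N)} {a b : ℝ}
    (ha : 0 ≤ a) (hb : b ≤ 1) {S : Set (EuclideanSpace ℝ (Fin N))}
    (hS : S ⊆ (fun t : ℝ => ξ + t • d) '' (Set.Icc 0 a ∪ Set.Icc b 1)) :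
    (μH[1] S).toReal ≤ ‖d‖ * (a + (1 - b)) := by
  have hlip : LipschitzWith ‖d‖₊ (fun t : ℝ => ξ + t • d) := by
    refine LipschitzWith.of_dist_le_mul fun x y => ?_
    rw [dist_add_left, dist_eq_norm, ← sub_smul, norm_smul, dist_eq_norm, coe_nnnorm, mul_comm]
  have hvol : volume (Set.Icc 0 a ∪ Set.Icc b 1) ≤ ENNReal.ofReal (a + (1 - b)) := by
    refine (measure_union_le _ _).trans ?_
    rw [Real.volume_Icc, Real.volume_Icc, ← ENNReal.ofReal_add (by linarith) (by linarith),
      sub_zero]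
  have hle : μH[1] S ≤ ENNReal.ofReal (‖d‖ * (a + (1 - b))) := by
    refine (measure_mono hS).trans ((hlip.hausdorffMeasure_image_le zero_le_one _).trans ?_)
    rw [hausdorffMeasure_real, ENNReal.rpow_one, ENNReal.ofReal_mul (norm_nonneg d),
      ofReal_norm]
    exact mul_le_mul_right hvol _
  exact ENNReal.toReal_le_of_le_ofReal (mul_nonneg (norm_nonneg d) (by linarith)) hle

/-- Subtracting from a convex function its supporting affine function at `ξ` leaves a function
that increases along rays issued from `ξ`. -/
theorem monotoneOn_sub_of_mem_subGrad {N : ℕ} {F : EuclideanSpace ℝ (Fin N) → ℝ}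
    (hFc : ConvexOn ℝ Set.univ F) {ξ ζ : EuclideanSpace ℝ (Fin N)} (hζ : ζ ∈ SubGrad F ξ)
    (d : EuclideanSpace ℝ (Fin N)) :
    MonotoneOn (fun t : ℝ => F (ξ + t • d) - t * ⟪ζ, d⟫) (Set.Ici 0) := by
  intro s hs t ht hst
  rcases eq_or_lt_of_le (show (0 : ℝ) ≤ t from ht) with h0 | h0
  · obtain rfl : s = t := le_antisymm hst (h0 ▸ hs)
    exact le_rfl
  have hs0 : (0 : ℝ) ≤ s := hs
  have hr1 : s / t ≤ 1 := (div_le_one h0).2 hst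
  have hr0 : 0 ≤ s / t := div_nonneg hs0 h0.le
  have hrt : s / t * t = s := div_mul_cancel₀ s h0.ne'
  have h1 := hFc.2 (Set.mem_univ (ξ + t • d)) (Set.mem_univ ξ) hr0 (sub_nonneg.2 hr1)
    (add_sub_cancel _ _)
  have h2 : (s / t) • (ξ + t • d) + (1 - s / t) • ξ = ξ + s • d := by
    rw [smul_add, smul_smul, hrt]; module
  rw [h2, smul_eq_mul, smul_eq_mul] at h1
  have h3 := hζ (ξ + t • d)
  rw [add_sub_cancel_left, inner_smul_right] at h3
  have h4 := mul_nonneg (sub_nonneg.2 hr1) (sub_nonneg.2 h3)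
  have h5 : s * ⟪ζ, d⟫ = s / t * t * ⟪ζ, d⟫ := by rw [hrt]
  dsimp only
  linarith

/-- Quadratic growth along a piece of a ray whose interior lies outside the ball. -/
theorem PhiUC.add_sq_le {N : ℕ} {F : EuclideanSpace ℝ (Fin N) → ℝ} {μ R : ℝ}
    (hFuc : PhiUC (fun _ => μ) R F) (hFc : ConvexOn ℝ Set.univ F)
    {ξ ζ : EuclideanSpace ℝ (Fin N)} (hζ : ζ ∈ SubGrad F ξ) (d : EuclideanSpace ℝ (Fin N))
    {s t : ℝ} (hs : 0 ≤ s) (hst : s ≤ t)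
    (hout : ∀ r ∈ Set.Ioo s t, R ≤ ‖ξ + r • d‖) :
    F (ξ + s • d) - s * ⟪ζ, d⟫ + μ * ((t - s) * ‖d‖) ^ 2 / 2 ≤ F (ξ + t • d) - t * ⟪ζ, d⟫ := by
  rcases eq_or_lt_of_le hst with rfl | hlt
  · simp
  have hout' : ∀ r ∈ Set.Icc s t, R ≤ ‖ξ + r • d‖ := by
    have hcl : IsClosed {r : ℝ | R ≤ ‖ξ + r • d‖} :=
      isClosed_le continuous_const (by fun_prop)
    have := closure_minimal (show Set.Ioo s t ⊆ {r : ℝ | R ≤ ‖ξ + r • d‖} from hout) hcl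
    rwa [closure_Ioo hlt.ne] at this
  refine add_sq_le_of_monotoneOn_of_uniformConvex (f := fun t => F (ξ + t • d) - t * ⟪ζ, d⟫) hst
    ((monotoneOn_sub_of_mem_subGrad hFc hζ d).mono fun r hr => hs.trans hr.1) fun θ hθ => ?_
  have hcomb : ∀ α β : ℝ, α + β = 1 →
      α • (ξ + t • d) + β • (ξ + s • d) = ξ + (α * t + β * s) • d := by
    intro α β h
    obtain rfl : β = 1 - α := by linarith
    module
  have h1 := hFuc (ξ + t • d) (ξ + s • d) (by
    rintro w ⟨α, β, hα, hβ, hαβ, rfl⟩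
    rw [hcomb α β hαβ]
    apply hout'
    obtain rfl : β = 1 - α := by linarith
    constructor <;> nlinarith) θ hθ
  have h2 : ‖ξ + t • d - (ξ + s • d)‖ = (t - s) * ‖d‖ := by
    rw [add_sub_add_left_eq_sub, ← sub_smul, norm_smul, Real.norm_of_nonneg (by linarith)]
  rw [hcomb θ (1 - θ) (by ring), h2] at h1
  dsimp only at h1 ⊢
  linarith

/-- **Lemma A.2.** If `F` is convex and `μ`-uniformly convex outside `B_R`, then for all
`ξ, ξ' ∈ ℝ^N` and every `ζ ∈ ∂F(ξ)`,
`F(ξ') ≥ F(ξ) + ⟨ζ, ξ'−ξ⟩ + (μ/4) 𝓗¹([ξ,ξ'] \ B_R)²`. -/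
theorem subgradient_inequality_hausdorff
    {N : ℕ} (F : EuclideanSpace ℝ (Fin N) → ℝ) (μ R : ℝ)
    (hμ : 0 < μ) (hR : 0 < R)
    (hFc : ConvexOn ℝ Set.univ F)
    (hFuc : PhiUC (fun _ => μ) R F)
    (ξ ξ' : EuclideanSpace ℝ (Fin N))
    (ζ : EuclideanSpace ℝ (Fin N)) (hζ : ζ ∈ SubGrad F ξ) :
    F ξ + ⟪ζ, ξ' - ξ⟫ +
        (μ / 4) * ((μH[1] (segment ℝ ξ ξ' \ Metric.ball 0 R)).toReal)^2 ≤ F ξ' := by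
  set d := ξ' - ξ with hd
  obtain ⟨a, b, ha, hab, hb, hT, hT'⟩ := exists_endpoints_of_ordConnected
    (T := Set.Icc 0 1 ∩ {t : ℝ | ξ + t • d ∈ Metric.ball 0 R}) Set.inter_subset_left (by
      have hpre : {t : ℝ | ξ + t • d ∈ Metric.ball 0 R} =
          AffineMap.lineMap ξ ξ' ⁻¹' Metric.ball (0 : EuclideanSpace ℝ (Fin N)) R := by
        ext t
        simp [AffineMap.lineMap_apply, hd, add_comm]
      rw [hpre]
      exact ((convex_Icc 0 1).inter ((convex_ball _ R).affine_preimage _)).ordConnected)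
  have hout : ∀ r ∈ Set.Icc (0 : ℝ) 1, (r < a ∨ b < r) → R ≤ ‖ξ + r • d‖ := by
    intro r hr h
    by_contra hlt
    have := hT r ⟨hr, by simpa using hlt⟩
    rcases h with h | h <;> linarith
  have h1 := hFuc.add_sq_le hFc hζ d le_rfl ha fun r hr =>
    hout r ⟨hr.1.le, by linarith [hr.2]⟩ (Or.inl hr.2)
  have h2 := monotoneOn_sub_of_mem_subGrad hFc hζ d ha (ha.trans hab) hab
  have h3 := hFuc.add_sq_le hFc hζ d (ha.trans hab) hb fun r hr =>
    hout r ⟨by linarith [hr.1], hr.2.le⟩ (Or.inr hr.1)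
  have hH : (μH[1] (segment ℝ ξ ξ' \ Metric.ball 0 R)).toReal ≤ ‖d‖ * (a + (1 - b)) := by
    refine toReal_hausdorffMeasure_le (ξ := ξ) ha hb ?_
    rintro w ⟨hw, hwR⟩
    rw [segment_eq_image'] at hw
    obtain ⟨t, ht, rfl⟩ := hw
    refine ⟨t, ?_, rfl⟩
    by_contra hcon
    have hat : a < t := by
      by_contra h
      exact hcon (Or.inl ⟨ht.1, not_lt.1 h⟩)
    have htb : t < b := by
      by_contra h
      exact hcon (Or.inr ⟨not_lt.1 h, ht.2⟩)
    exact hwR (hT' t hat htb).2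
  have hsq := pow_le_pow_left₀ ENNReal.toReal_nonneg hH 2
  have h4 := mul_le_mul_of_nonneg_left hsq (show 0 ≤ μ / 4 by positivity)
  have h5 := mul_nonneg hμ.le (sq_nonneg (a * ‖d‖ - (1 - b) * ‖d‖))
  have h6 : ξ + (1 : ℝ) • d = ξ' := by rw [one_smul, hd, add_sub_cancel]
  rw [h6] at h3
  simp only [zero_smul, add_zero, zero_mul, sub_zero] at h1
  dsimp only at h2
  nlinarith

end
end

section
/- Let F : ℝ^N → ℝ be a convex function which is μ-uniformly convex outside the ball B_R = B_R(0) ⊂ ℝ^N. Then: (i) for every ξ, ξ' ∈ ℝ^N with |ξ| ≥ 2R or |ξ'| ≥ 2R, and every ζ ∈ ∂F(ξ), one has F(ξ') ≥ F(ξ) + ⟨ζ, ξ' − ξ⟩ + (μ/36)|ξ' − ξ|²; (ii) for every such ξ, ξ' and every ζ ∈ ∂F(ξ), ζ' ∈ ∂F(ξ'), one has ⟨ζ − ζ', ξ − ξ'⟩ ≥ (μ/18)|ξ − ξ'|². -/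
open MeasureTheory Filter
open scoped InnerProductSpace RealInnerProductSpace ENNReal NNReal Topology

noncomputable section

/-- If an endpoint of a segment has norm at least `2R`, its first and last quarters cannot both
meet the open ball of radius `R`. -/
theorem first_or_last_quarter_outside_ball {E : Type*} [NormedAddCommGroup E] [NormedSpace ℝ E]
    {R : ℝ} (hR : 0 < R) (x v : E) (h : 2 * R ≤ ‖x‖ ∨ 2 * R ≤ ‖x + v‖) :
    (∀ t ∈ Set.Icc (0 : ℝ) (1 / 4), R ≤ ‖x + t • v‖) ∨
      (∀ t ∈ Set.Icc (3 / 4 : ℝ) 1, R ≤ ‖x + t • v‖) := by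
  by_contra! hcon
  obtain ⟨⟨t, ⟨ht0, ht1⟩, ht⟩, ⟨s, ⟨hs0, hs1⟩, hs⟩⟩ := hcon
  have key : ∀ (y : E) (a b : ℝ), 0 ≤ a → 0 ≤ b → a + b ≤ 2 * (s - t) → 2 * R ≤ ‖y‖ →
      (s - t) • y = a • (x + t • v) - b • (x + s • v) → 0 < a + b → False := by
    intro y a b ha hb hab hy he hpos
    have h1 : (s - t) * ‖y‖ ≤ a * ‖x + t • v‖ + b * ‖x + s • v‖ := by
      calc (s - t) * ‖y‖ = ‖(s - t) • y‖ := by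
            rw [norm_smul, Real.norm_of_nonneg (by linarith)]
        _ ≤ ‖a • (x + t • v)‖ + ‖b • (x + s • v)‖ := by rw [he]; exact norm_sub_le _ _
        _ = _ := by rw [norm_smul, norm_smul, Real.norm_of_nonneg ha, Real.norm_of_nonneg hb]
    have h2 : (s - t) * (2 * R) ≤ (s - t) * ‖y‖ := mul_le_mul_of_nonneg_left hy (by linarith)
    have h3 : (a + b) * R ≤ 2 * (s - t) * R := mul_le_mul_of_nonneg_right hab hR.le
    have h4 : a * ‖x + t • v‖ + b * ‖x + s • v‖ < (a + b) * R := by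
      rcases ha.eq_or_lt with h0 | h0
      · have : 0 < b := by linarith
        nlinarith
      · nlinarith
    linarith
  rcases h with h | h
  · exact key x s t (by linarith) ht0 (by linarith) h (by module) (by linarith)
  · refine key (-(x + v)) (1 - s) (1 - t) (by linarith) (by linarith) (by linarith)
      (by rwa [norm_neg]) (by module) (by linarith)

/-- A convex function which is uniformly convex outside `B_R` lies quadratically above its
supporting hyperplanes along segments with a far endpoint. -/
theorem PhiUC.subgrad_quadratic_lower_bound
    {N : ℕ} {F : EuclideanSpace ℝ (Fin N) → ℝ} {μ R : ℝ} (hμ : 0 < μ) (hR : 0 < R)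
    (hFc : ConvexOn ℝ Set.univ F) (hFuc : PhiUC (fun _ => μ) R F)
    (x v ζ : EuclideanSpace ℝ (Fin N)) (h : 2 * R ≤ ‖x‖ ∨ 2 * R ≤ ‖x + v‖)
    (hζ : ζ ∈ SubGrad F x) :
    F x + ⟪ζ, v⟫ + (μ / 36) * ‖v‖ ^ 2 ≤ F (x + v) := by
  have hsub : ∀ t : ℝ, F x + t * ⟪ζ, v⟫ ≤ F (x + t • v) := by
    intro t
    have := hζ (x + t • v)
    rwa [add_sub_cancel_left, inner_smul_right] at this
  have hconv : ∀ t θ : ℝ, 0 ≤ θ → θ ≤ 1 →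
      F (x + (θ * t) • v) ≤ θ * F (x + t • v) + (1 - θ) * F x := by
    intro t θ h0 h1
    have := hFc.2 (Set.mem_univ (x + t • v)) (Set.mem_univ x) h0 (sub_nonneg.2 h1) (by ring)
    rwa [show θ • (x + t • v) + (1 - θ) • x = x + (θ * t) • v by module] at this
  have huc : ∀ a b : ℝ, a ≤ b → (∀ t ∈ Set.Icc a b, R ≤ ‖x + t • v‖) → ∀ θ ∈ Set.Icc (0 : ℝ) 1,
      F (x + (θ * b + (1 - θ) * a) • v) ≤ θ * F (x + b • v) + (1 - θ) * F (x + a • v)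
        - 1 / 2 * θ * (1 - θ) * μ * ((b - a) ^ 2 * ‖v‖ ^ 2) := by
    intro a b hab hout θ hθ
    have := hFuc (x + b • v) (x + a • v) (by
      rintro w ⟨p, q, hp, hq, hpq, rfl⟩
      obtain rfl : q = 1 - p := by linarith
      rw [show p • (x + b • v) + (1 - p) • (x + a • v) = x + (p * b + (1 - p) * a) • v by module]
      exact hout _ ⟨by nlinarith, by nlinarith⟩) θ hθ
    rwa [show θ • (x + b • v) + (1 - θ) • (x + a • v) = x + (θ * b + (1 - θ) * a) • v by module,
      show x + b • v - (x + a • v) = (b - a) • v by module, norm_smul, mul_pow, Real.norm_eq_abs,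
      sq_abs] at this
  have hv : 0 ≤ μ * ‖v‖ ^ 2 := by positivity
  rcases first_or_last_quarter_outside_ball hR x v h with hout | hout
  · have h1 := huc 0 (1 / 4) (by norm_num) hout (1 / 2) (by norm_num)
    have h2 := hsub (1 / 8)
    have h3 := hconv 1 (1 / 4) (by norm_num) (by norm_num)
    norm_num at h1 h2 h3
    linarith
  · have h1 := huc (3 / 4) 1 (by norm_num) hout (1 / 9) (by norm_num)
    have h2 := hsub (3 / 4)
    have h3 := hconv (7 / 9) (27 / 28) (by norm_num) (by norm_num)
    norm_num at h1 h2 h3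
    linarith

/-- **Lemma A.3 (i)–(ii).** If `F` is convex and `μ`-uniformly convex outside `B_R`, then
whenever `|ξ| ≥ 2R` or `|ξ'| ≥ 2R`:
(i) `F(ξ') ≥ F(ξ) + ⟨ζ, ξ'−ξ⟩ + (μ/36)|ξ'−ξ|²` for every `ζ ∈ ∂F(ξ)`;
(ii) `⟨ζ−ζ', ξ−ξ'⟩ ≥ (μ/18)|ξ−ξ'|²` for every `ζ ∈ ∂F(ξ)`, `ζ' ∈ ∂F(ξ')`. -/
theorem uniformly_convex_outside_ball_subgrad_estimates
    {N : ℕ} (F : EuclideanSpace ℝ (Fin N) → ℝ) (μ R : ℝ)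
    (hμ : 0 < μ) (hR : 0 < R)
    (hFc : ConvexOn ℝ Set.univ F)
    (hFuc : PhiUC (fun _ => μ) R F) :
    (∀ ξ ξ' : EuclideanSpace ℝ (Fin N), (2 * R ≤ ‖ξ‖ ∨ 2 * R ≤ ‖ξ'‖) →
      ∀ ζ ∈ SubGrad F ξ,
        F ξ + ⟪ζ, ξ' - ξ⟫ + (μ / 36) * ‖ξ' - ξ‖^2 ≤ F ξ') ∧
    (∀ ξ ξ' : EuclideanSpace ℝ (Fin N), (2 * R ≤ ‖ξ‖ ∨ 2 * R ≤ ‖ξ'‖) →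
      ∀ ζ ∈ SubGrad F ξ, ∀ ζ' ∈ SubGrad F ξ',
        (μ / 18) * ‖ξ - ξ'‖^2 ≤ ⟪ζ - ζ', ξ - ξ'⟫) := by
  have lower : ∀ ξ ξ' : EuclideanSpace ℝ (Fin N), (2 * R ≤ ‖ξ‖ ∨ 2 * R ≤ ‖ξ'‖) →
      ∀ ζ ∈ SubGrad F ξ, F ξ + ⟪ζ, ξ' - ξ⟫ + (μ / 36) * ‖ξ' - ξ‖ ^ 2 ≤ F ξ' := by
    intro ξ ξ' h ζ hζ
    have := hFuc.subgrad_quadratic_lower_bound hμ hR hFc ξ (ξ' - ξ) ζ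
      (by rwa [add_sub_cancel]) hζ
    rwa [add_sub_cancel] at this
  refine ⟨lower, fun ξ ξ' h ζ hζ ζ' hζ' => ?_⟩
  have h1 := lower ξ ξ' h ζ hζ
  have h2 := lower ξ' ξ h.symm ζ' hζ'
  rw [norm_sub_rev, ← neg_sub ξ ξ', inner_neg_right] at h1
  rw [inner_sub_left]
  linarith

end
end

section
/- Let F : ℝ^N → ℝ be a convex function which is μ-uniformly convex outside the ball B_R. Then there exists a nondecreasing sequence {F_k}_{k∈ℕ} of smooth convex functions on ℝ^N which converges to F uniformly on bounded sets, and such that for every k ≥ 2R the function F_k is (μ/36)-uniformly convex outside the ball B_{R+1}. -/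
open MeasureTheory Filter
open scoped InnerProductSpace RealInnerProductSpace ENNReal NNReal Topology

noncomputable section

section MoreauEnvelope

variable {E : Type*} [NormedAddCommGroup E]

/-- `G` is the Moreau envelope of `F` with parameter `l`, attained along the proximal map `p`. -/
structure IsMoreauEnvelope (F : E → ℝ) (l : ℝ) (G : E → ℝ) (p : E → E) : Prop where
  eq_prox : ∀ x, G x = F (p x) + l / 2 * ‖x - p x‖ ^ 2
  le : ∀ x y, G x ≤ F y + l / 2 * ‖x - y‖ ^ 2

namespace IsMoreauEnvelope

variable {F G G' : E → ℝ} {l l' : ℝ} {p p' : E → E}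

lemma le_self (h : IsMoreauEnvelope F l G p) (x : E) : G x ≤ F x := by
  simpa using h.le x x

lemma mono (h : IsMoreauEnvelope F l G p) (h' : IsMoreauEnvelope F l' G' p') (hl : l ≤ l')
    (x : E) : G x ≤ G' x := by
  rw [h'.eq_prox]
  refine (h.le x (p' x)).trans ?_
  gcongr

end IsMoreauEnvelope

variable [InnerProductSpace ℝ E]

/-- A convex function on a finite-dimensional space lies above a downward cone at each point. -/
lemma ConvexOn.exists_sub_mul_norm_le [FiniteDimensional ℝ E] {F : E → ℝ}
    (hF : ConvexOn ℝ Set.univ F) (x : E) :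
    ∃ C : ℝ, 0 ≤ C ∧ ∀ y, F x - C * ‖y - x‖ ≤ F y := by
  obtain ⟨K, t, ht, hK⟩ := hF.locallyLipschitz x
  obtain ⟨ε, hε, hball⟩ := Metric.mem_nhds_iff.1 ht
  refine ⟨K, K.2, fun y => ?_⟩
  set d := ‖y - x‖ with hd
  have hd0 : 0 ≤ d := norm_nonneg _
  set s : ℝ := ε / (ε + d + 1) with hs
  have hs0 : 0 < s := by positivity
  have hs1 : s ≤ 1 := by rw [hs, div_le_one (by positivity)]; linarith
  have hsd : s * d < ε := by
    rw [hs, div_mul_eq_mul_div, div_lt_iff₀ (by positivity)]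
    nlinarith
  have hq : ‖(1 - s) • x + s • y - x‖ = s * d := by
    have : (1 - s) • x + s • y - x = s • (y - x) := by module
    rw [this, norm_smul, Real.norm_of_nonneg hs0.le]
  have hlip := hK.dist_le_mul ((1 - s) • x + s • y)
    (hball (by rw [Metric.mem_ball, dist_eq_norm, hq]; exact hsd)) x
    (hball (Metric.mem_ball_self hε))
  rw [Real.dist_eq, dist_eq_norm, hq] at hlip
  have hlow := neg_le_of_abs_le hlip
  have hconv := hF.2 (Set.mem_univ x) (Set.mem_univ y) (sub_nonneg.2 hs1) hs0.le (by ring)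
  simp only [smul_eq_mul] at hconv
  have : 0 ≤ s * (F y - F x + K * d) := by nlinarith
  have := nonneg_of_mul_nonneg_right this hs0
  linarith

lemma ConvexOn.exists_isMoreauEnvelope [FiniteDimensional ℝ E] {F : E → ℝ}
    (hF : ConvexOn ℝ Set.univ F) {l : ℝ} (hl : 0 < l) :
    ∃ (G : E → ℝ) (p : E → E), IsMoreauEnvelope F l G p := by
  have hcont : Continuous F := hF.locallyLipschitz.continuous
  have key : ∀ x : E, ∃ q, ∀ y, F q + l / 2 * ‖x - q‖ ^ 2 ≤ F y + l / 2 * ‖x - y‖ ^ 2 := by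
    intro x
    obtain ⟨C, hC, hcone⟩ := hF.exists_sub_mul_norm_le x
    refine Continuous.exists_forall_le (by fun_prop) ?_
    have hnorm : Tendsto (fun y : E => ‖y - x‖) (cocompact E) atTop := by
      refine tendsto_atTop_mono (fun y => norm_sub_norm_le y x) ?_
      exact tendsto_atTop_add_const_right _ _ tendsto_norm_cocompact_atTop
    have hlin : Tendsto (fun y : E => ‖y - x‖ + (F x - (C + 1) ^ 2 / (2 * l)))
        (cocompact E) atTop := tendsto_atTop_add_const_right _ _ hnorm
    refine tendsto_atTop_mono (fun y => ?_) hlin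
    have h1 := hcone y
    rw [norm_sub_rev x y]
    have h2 : (C + 1) * ‖y - x‖ ≤ l / 2 * ‖y - x‖ ^ 2 + (C + 1) ^ 2 / (2 * l) := by
      have : l / 2 * ‖y - x‖ ^ 2 + (C + 1) ^ 2 / (2 * l) - (C + 1) * ‖y - x‖
          = (l * ‖y - x‖ - (C + 1)) ^ 2 / (2 * l) := by field_simp; ring
      have : 0 ≤ (l * ‖y - x‖ - (C + 1)) ^ 2 / (2 * l) := by positivity
      linarith
    linarith
  choose p hp using key
  exact ⟨fun x => F (p x) + l / 2 * ‖x - p x‖ ^ 2, p, fun _ => rfl, hp⟩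

lemma norm_sq_combo (a b : E) (θ : ℝ) :
    ‖θ • a + (1 - θ) • b‖ ^ 2 =
      θ * ‖a‖ ^ 2 + (1 - θ) * ‖b‖ ^ 2 - θ * (1 - θ) * ‖a - b‖ ^ 2 := by
  rw [norm_add_sq_real, norm_sub_sq_real, norm_smul, norm_smul, mul_pow, mul_pow,
    inner_smul_left, inner_smul_right, Real.norm_eq_abs, Real.norm_eq_abs, sq_abs, sq_abs]
  simp only [conj_trivial]
  ring

namespace IsMoreauEnvelope

variable {F G : E → ℝ} {l : ℝ} {p : E → E}

lemma convexOn (h : IsMoreauEnvelope F l G p) (hl : 0 ≤ l) (hF : ConvexOn ℝ Set.univ F) :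
    ConvexOn ℝ Set.univ G := by
  refine ⟨convex_univ, fun x _ y _ a b ha hb hab => ?_⟩
  obtain rfl : b = 1 - a := by linarith
  have h1 := h.le (a • x + (1 - a) • y) (a • p x + (1 - a) • p y)
  have h2 := hF.2 (Set.mem_univ (p x)) (Set.mem_univ (p y)) ha hb hab
  have h3 : a • x + (1 - a) • y - (a • p x + (1 - a) • p y)
      = a • (x - p x) + (1 - a) • (y - p y) := by module
  rw [h3, norm_sq_combo] at h1
  simp only [smul_eq_mul] at h2 ⊢
  rw [h.eq_prox x, h.eq_prox y]
  have : 0 ≤ l / 2 * (a * (1 - a) * ‖x - p x - (y - p y)‖ ^ 2) := by positivity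
  linarith

/-- The second differences of a Moreau envelope are bounded by its parameter. -/
lemma add_le (h : IsMoreauEnvelope F l G p) (x t : E) :
    G (x - t) + G (x + t) ≤ 2 * G x + l * ‖t‖ ^ 2 := by
  have h1 := h.le (x - t) (p x)
  have h2 := h.le (x + t) (p x)
  rw [sub_right_comm, norm_sub_sq_real] at h1
  rw [add_sub_right_comm, norm_add_sq_real] at h2
  rw [h.eq_prox x]
  linarith

/-- The proximal map is Lipschitz. -/
lemma norm_prox_sub_le (h : IsMoreauEnvelope F l G p) (hl : 0 < l)
    (hF : ConvexOn ℝ Set.univ F) (x y : E) : ‖p x - p y‖ ≤ 2 * ‖x - y‖ := by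
  set u : E := (1 / 2 : ℝ) • (p y - p x) with hu
  have hx := h.le x ((1 / 2 : ℝ) • p x + (1 / 2 : ℝ) • p y)
  have hy := h.le y ((1 / 2 : ℝ) • p x + (1 / 2 : ℝ) • p y)
  have hm := hF.2 (Set.mem_univ (p x)) (Set.mem_univ (p y)) (by norm_num : (0 : ℝ) ≤ 1 / 2)
    (by norm_num : (0 : ℝ) ≤ 1 / 2) (by norm_num)
  simp only [smul_eq_mul] at hm
  have ex : x - ((1 / 2 : ℝ) • p x + (1 / 2 : ℝ) • p y) = (x - p x) - u := by
    rw [hu]; module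
  have ey : y - ((1 / 2 : ℝ) • p x + (1 / 2 : ℝ) • p y) = (y - p y) + u := by
    rw [hu]; module
  rw [ex, norm_sub_sq_real, h.eq_prox] at hx
  rw [ey, norm_add_sq_real, h.eq_prox] at hy
  have hinner : ⟪y - p y, u⟫ - ⟪x - p x, u⟫ = ⟪y - x, u⟫ - 2 * ‖u‖ ^ 2 := by
    rw [← inner_sub_left, ← real_inner_self_eq_norm_sq]
    have : y - p y - (x - p x) = (y - x) - (2 : ℝ) • u := by rw [hu]; module
    rw [this, inner_sub_left, inner_smul_left]
    simp
  have h4 : 0 ≤ l * (⟪y - x, u⟫ - ‖u‖ ^ 2) := by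
    have : l * (⟪y - p y, u⟫ - ⟪x - p x, u⟫) = l * (⟪y - x, u⟫ - 2 * ‖u‖ ^ 2) := by rw [hinner]
    linarith
  have h5 := nonneg_of_mul_nonneg_right h4 hl
  have h6 := real_inner_le_norm (y - x) u
  have h7 : ‖u‖ ≤ ‖y - x‖ := by
    by_contra! hlt
    have : 0 ≤ ‖y - x‖ := norm_nonneg _
    nlinarith
  have h8 : ‖u‖ = 1 / 2 * ‖p x - p y‖ := by
    rw [hu, norm_smul, norm_sub_rev]; norm_num
  rw [norm_sub_rev x y]
  linarith

/-- For a large parameter, the proximal map moves no point far into a ball where `F` is bounded. -/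
lemma le_norm_prox (h : IsMoreauEnvelope F l G p) {R M : ℝ}
    (hM : ∀ y, ‖y‖ ≤ R + 1 → |F y| ≤ M) (hl : 64 * M ≤ l) (hl0 : 0 < l) {x : E}
    (hx : R + 1 / 2 ≤ ‖x‖) : R + 1 / 4 ≤ ‖p x‖ := by
  by_contra! hp
  set d := ‖x - p x‖ with hd
  have hd4 : 1 / 4 < d := by
    have := norm_sub_norm_le x (p x)
    linarith
  set s : ℝ := 1 / (4 * d) with hs
  have hsd : s * d = 1 / 4 := by rw [hs]; field_simp
  have hs0 : 0 < s := by rw [hs]; positivity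
  have hs1 : s < 1 := by rw [hs, div_lt_one (by positivity)]; linarith
  set q := p x + s • (x - p x) with hq
  have hqn : ‖q‖ ≤ R + 1 := by
    have h1 := norm_add_le (p x) (s • (x - p x))
    rw [norm_smul, Real.norm_of_nonneg hs0.le, ← hd, hsd] at h1
    linarith
  have hxq : ‖x - q‖ = d - 1 / 4 := by
    have : x - q = (1 - s) • (x - p x) := by rw [hq]; module
    rw [this, norm_smul, Real.norm_of_nonneg (by linarith), ← hd, ← hsd]
    ring
  have hle := h.le x q
  rw [h.eq_prox, hxq] at hle
  have h1 := (abs_le.1 (hM q hqn)).2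
  have h2 := (abs_le.1 (hM (p x) (by linarith))).1
  nlinarith

lemma tendsto [FiniteDimensional ℝ E] (hF : ConvexOn ℝ Set.univ F) {l : ℕ → ℝ}
    (hl0 : ∀ k, 0 < l k) (hl : Tendsto l atTop atTop) {G : ℕ → E → ℝ} {p : ℕ → E → E}
    (h : ∀ k, IsMoreauEnvelope F (l k) (G k) (p k)) (x : E) :
    Tendsto (fun k => G k x) atTop (𝓝 (F x)) := by
  obtain ⟨C, hC, hcone⟩ := hF.exists_sub_mul_norm_le x
  have hlow : Tendsto (fun k => F x - C ^ 2 / 2 * (l k)⁻¹) atTop (𝓝 (F x)) := by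
    simpa using tendsto_const_nhds.sub ((tendsto_inv_atTop_zero.comp hl).const_mul (C ^ 2 / 2))
  refine tendsto_of_tendsto_of_tendsto_of_le_of_le hlow tendsto_const_nhds (fun k => ?_)
    (fun k => (h k).le_self x)
  have h1 := hcone (p k x)
  have hk := hl0 k
  rw [norm_sub_rev] at h1
  simp only [(h k).eq_prox]
  have : l k / 2 * ‖x - p k x‖ ^ 2 + C ^ 2 / 2 * (l k)⁻¹ - C * ‖x - p k x‖
      = (l k * ‖x - p k x‖ - C) ^ 2 / (2 * l k) := by field_simp; ring
  have : 0 ≤ (l k * ‖x - p k x‖ - C) ^ 2 / (2 * l k) := by positivity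
  linarith

end IsMoreauEnvelope

end MoreauEnvelope

section Mollify

variable {E : Type*} [NormedAddCommGroup E] [InnerProductSpace ℝ E] [FiniteDimensional ℝ E]
  [MeasurableSpace E] [BorelSpace E]

/-- The convolution of `G` with a normalized bump function. -/
def mollify (φ : ContDiffBump (0 : E)) (G : E → ℝ) (x : E) : ℝ :=
  ∫ t, φ.normed volume t * G (x - t)

variable (φ : ContDiffBump (0 : E)) {G : E → ℝ}

lemma contDiff_mollify (hG : Continuous G) : ContDiff ℝ (⊤ : ℕ∞) (mollify φ G) :=
  (φ.hasCompactSupport_normed (μ := volume)).contDiff_convolution_left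
    (ContinuousLinearMap.lsmul ℝ ℝ) φ.contDiff_normed hG.locallyIntegrable

lemma integrable_normed_mul {g : E → ℝ} (hg : Continuous g) :
    Integrable (fun t => φ.normed volume t * g t) volume :=
  (φ.continuous_normed.mul hg).integrable_of_hasCompactSupport
    (φ.hasCompactSupport_normed (μ := volume)).mul_right

lemma integral_normed_mul_le {g g' : E → ℝ} (hg : Continuous g) (hg' : Continuous g')
    (hle : ∀ t, ‖t‖ ≤ φ.rOut → g t ≤ g' t) :
    ∫ t, φ.normed volume t * g t ≤ ∫ t, φ.normed volume t * g' t := by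
  refine integral_mono (integrable_normed_mul φ hg) (integrable_normed_mul φ hg') fun t => ?_
  by_cases ht : ‖t‖ ≤ φ.rOut
  · exact mul_le_mul_of_nonneg_left (hle t ht) (φ.nonneg_normed t)
  · have : φ.normed volume t = 0 := by
      rw [← Function.notMem_support, φ.support_normed_eq, mem_ball_zero_iff]
      exact fun h => ht h.le
    simp [this]

lemma integral_normed_mul_const (c : ℝ) : ∫ t, φ.normed volume t * c = c := by
  rw [integral_mul_const, φ.integral_normed, one_mul]

lemma mollify_combo_le (hG : Continuous G) {a z z' : E} {θ θ' c : ℝ}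
    (h : ∀ t, ‖t‖ ≤ φ.rOut → G (a - t) ≤ θ * G (z - t) + θ' * G (z' - t) - c) :
    mollify φ G a ≤ θ * mollify φ G z + θ' * mollify φ G z' - c := by
  have hz : Integrable (fun t => φ.normed volume t * G (z - t)) volume :=
    integrable_normed_mul φ (by fun_prop)
  have hz' : Integrable (fun t => φ.normed volume t * G (z' - t)) volume :=
    integrable_normed_mul φ (by fun_prop)
  have hc : Integrable (fun t => φ.normed volume t * c) volume :=
    integrable_normed_mul φ continuous_const
  calc mollify φ G a
      ≤ ∫ t, φ.normed volume t * (θ * G (z - t) + θ' * G (z' - t) - c) :=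
        integral_normed_mul_le φ (by fun_prop) (by fun_prop) h
    _ = ∫ t, (θ * (φ.normed volume t * G (z - t)) + θ' * (φ.normed volume t * G (z' - t))
          - φ.normed volume t * c) := by
        congr 1; ext t; ring
    _ = θ * mollify φ G z + θ' * mollify φ G z' - c := by
        have hsum : Integrable (fun t => θ * (φ.normed volume t * G (z - t))
            + θ' * (φ.normed volume t * G (z' - t))) volume :=
          (hz.const_mul θ).add (hz'.const_mul θ')
        rw [integral_sub hsum hc, integral_add (hz.const_mul θ) (hz'.const_mul θ'), integral_const_mul,
          integral_const_mul, integral_normed_mul_const]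
        rfl

lemma convexOn_mollify (hG : Continuous G) (hGc : ConvexOn ℝ Set.univ G) :
    ConvexOn ℝ Set.univ (mollify φ G) := by
  refine ⟨convex_univ, fun x _ y _ a b ha hb hab => ?_⟩
  have := mollify_combo_le φ hG (a := a • x + b • y) (z := x) (z' := y) (θ := a) (θ' := b)
    (c := 0) fun t _ => ?_
  · simpa using this
  · have h1 := hGc.2 (Set.mem_univ (x - t)) (Set.mem_univ (y - t)) ha hb hab
    have h2 : a • (x - t) + b • (y - t) = a • x + b • y - t := by
      obtain rfl : b = 1 - a := by linarith
      module
    rw [h2] at h1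
    simpa using h1

lemma two_mul_mollify (hG : Continuous G) (x : E) :
    2 * mollify φ G x = ∫ t, φ.normed volume t * (G (x - t) + G (x + t)) := by
  have h1 : mollify φ G x = ∫ t, φ.normed volume t * G (x + t) := by
    rw [mollify, ← integral_neg_eq_self]
    simp [φ.normed_neg]
  simp_rw [mul_add]
  rw [integral_add (integrable_normed_mul φ (by fun_prop))
    (integrable_normed_mul φ (by fun_prop)), ← h1, two_mul]
  rfl

lemma le_mollify (hG : Continuous G) (hGc : ConvexOn ℝ Set.univ G) (x : E) :
    G x ≤ mollify φ G x := by
  have h := integral_normed_mul_le φ (g := fun _ => 2 * G x)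
    (g' := fun t => G (x - t) + G (x + t)) (by fun_prop) (by fun_prop) fun t _ => ?_
  · rw [integral_normed_mul_const, ← two_mul_mollify φ hG] at h
    linarith
  · have h1 := hGc.2 (Set.mem_univ (x - t)) (Set.mem_univ (x + t))
      (by norm_num : (0 : ℝ) ≤ 1 / 2) (by norm_num : (0 : ℝ) ≤ 1 / 2) (by norm_num)
    have h2 : (1 / 2 : ℝ) • (x - t) + (1 / 2 : ℝ) • (x + t) = x := by module
    rw [h2] at h1
    simp only [smul_eq_mul] at h1
    linarith

lemma mollify_le (hG : Continuous G) {l : ℝ} (hl : 0 ≤ l)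
    (h : ∀ x t, G (x - t) + G (x + t) ≤ 2 * G x + l * ‖t‖ ^ 2) (x : E) :
    mollify φ G x ≤ G x + l / 2 * φ.rOut ^ 2 := by
  have h := integral_normed_mul_le φ (g := fun t => G (x - t) + G (x + t))
    (g' := fun _ => 2 * G x + l * φ.rOut ^ 2) (by fun_prop) (by fun_prop) fun t ht =>
      (h x t).trans (by gcongr)
  rw [integral_normed_mul_const, ← two_mul_mollify φ hG] at h
  linarith

end Mollify

section PhiUC

variable {N : ℕ} {F G : EuclideanSpace ℝ (Fin N) → ℝ} {R : ℝ}

/-- A continuous function satisfying a local midpoint inequality outside a ball is uniformly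
convex there. -/
lemma phiUC_of_local_midpoint {c c' δ : ℝ} (hG : Continuous G) (hc : c' < c) (hδ : 0 < δ)
    (h : ∀ x y, R ≤ ‖x‖ → R ≤ ‖y‖ → ‖x - y‖ ≤ δ →
      G ((1 / 2 : ℝ) • x + (1 / 2 : ℝ) • y) ≤ (G x + G y) / 2 - c / 8 * ‖x - y‖ ^ 2) :
    PhiUC (fun _ => c') R G := by
  intro z z' hseg θ hθ
  rcases eq_or_ne z z' with rfl | hne
  · have : θ • z + (1 - θ) • z = z := by module
    rw [this]
    simp
    linarith
  set L := ‖z - z'‖ with hLdef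
  have hL : 0 < L := norm_pos_iff.2 (sub_ne_zero.2 hne)
  have hout : ∀ t ∈ Set.Icc (0 : ℝ) 1, R ≤ ‖t • z + (1 - t) • z'‖ := fun t ht =>
    hseg _ ⟨t, 1 - t, ht.1, by linarith [ht.2], by ring, rfl⟩
  set f : ℝ → ℝ := fun t => G (t • z + (1 - t) • z') - t * G z - (1 - t) * G z'
    + c' / 2 * t * (1 - t) * L ^ 2 with hf
  have hfc : Continuous f := by fun_prop
  obtain ⟨s, hs, hmax⟩ := isCompact_Icc.exists_isMaxOn
    (Set.nonempty_Icc.2 (zero_le_one (α := ℝ))) hfc.continuousOn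
  suffices hfs : f s ≤ 0 by
    have := (hmax hθ).trans hfs
    simp only [hf] at this
    linarith
  by_contra! hpos
  have hs0 : 0 < s := by
    refine lt_of_le_of_ne hs.1 fun h0 => ?_
    rw [← h0] at hpos
    simp [hf] at hpos
  have hs1 : s < 1 := by
    refine lt_of_le_of_ne hs.2 fun h1 => ?_
    rw [h1] at hpos
    simp [hf] at hpos
  obtain ⟨η, hη0, hηs, hηs', hηδ⟩ : ∃ η : ℝ, 0 < η ∧ η ≤ s ∧ η ≤ 1 - s ∧ 2 * η * L ≤ δ := by
    refine ⟨min (min s (1 - s)) (δ / (2 * L)), ?_, ?_, ?_, ?_⟩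
    · have : 0 < 1 - s := by linarith
      positivity
    · exact (min_le_left _ _).trans (min_le_left _ _)
    · exact (min_le_left _ _).trans (min_le_right _ _)
    · have := min_le_right (min s (1 - s)) (δ / (2 * L))
      rw [le_div_iff₀ (by positivity)] at this
      linarith
  have hmem : s + η ∈ Set.Icc (0 : ℝ) 1 := ⟨by linarith, by linarith⟩
  have hmem' : s - η ∈ Set.Icc (0 : ℝ) 1 := ⟨by linarith, by linarith⟩
  have hdist : ‖((s + η) • z + (1 - (s + η)) • z') - ((s - η) • z + (1 - (s - η)) • z')‖
      = 2 * η * L := by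
    have : ((s + η) • z + (1 - (s + η)) • z') - ((s - η) • z + (1 - (s - η)) • z')
        = (2 * η) • (z - z') := by module
    rw [this, norm_smul, Real.norm_of_nonneg (by positivity)]
  have hmid := h _ _ (hout _ hmem) (hout _ hmem') (hdist.trans_le hηδ)
  have hmideq : (1 / 2 : ℝ) • ((s + η) • z + (1 - (s + η)) • z')
      + (1 / 2 : ℝ) • ((s - η) • z + (1 - (s - η)) • z') = s • z + (1 - s) • z' := by module
  rw [hdist, hmideq] at hmid
  have h1 : f (s + η) ≤ f s := hmax hmem
  have h2 : f (s - η) ≤ f s := hmax hmem'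
  simp only [hf] at h1 h2
  have h3 : 0 < (c - c') * (η ^ 2 * L ^ 2) := mul_pos (by linarith) (by positivity)
  nlinarith

lemma IsMoreauEnvelope.phiUC {μ M l c : ℝ} {p : EuclideanSpace ℝ (Fin N) → _}
    (h : IsMoreauEnvelope F l G p) (hμ : 0 < μ) (hFc : ConvexOn ℝ Set.univ F)
    (hFuc : PhiUC (fun _ => μ) R F) (hM : ∀ y, ‖y‖ ≤ R + 1 → |F y| ≤ M)
    (hlM : 64 * M ≤ l) (hlμ : μ ≤ l) (hc : c < μ / 2) :
    PhiUC (fun _ => c) (R + 1 / 2) G := by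
  have hl : 0 < l := hμ.trans_le hlμ
  refine phiUC_of_local_midpoint (h.convexOn hl.le hFc).locallyLipschitz.continuous hc
    (by norm_num : (0 : ℝ) < 1 / 8) fun x y hx hy hxy => ?_
  have hpx := h.le_norm_prox hM hlM hl hx
  have hpxy := h.norm_prox_sub_le hl hFc x y
  have huc := hFuc (p x) (p y) (fun w hw => ?_) (1 / 2) (by norm_num)
  · have h1 := h.le ((1 / 2 : ℝ) • x + (1 / 2 : ℝ) • y) ((1 / 2 : ℝ) • p x + (1 / 2 : ℝ) • p y)
    have h2 : (1 / 2 : ℝ) • x + (1 / 2 : ℝ) • y - ((1 / 2 : ℝ) • p x + (1 / 2 : ℝ) • p y)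
        = (1 / 2 : ℝ) • (x - p x) + (1 - 1 / 2 : ℝ) • (y - p y) := by module
    rw [h2, norm_sq_combo] at h1
    have h3 : (1 - 1 / 2 : ℝ) = 1 / 2 := by norm_num
    rw [h3] at h1 huc
    have h4 : ‖x - y‖ ^ 2 ≤ 2 * (‖p x - p y‖ ^ 2 + ‖x - p x - (y - p y)‖ ^ 2) := by
      have h5 : x - y = (p x - p y) + (x - p x - (y - p y)) := by abel
      have h6 := norm_add_le (p x - p y) (x - p x - (y - p y))
      rw [← h5] at h6
      nlinarith [norm_nonneg (x - y), sq_nonneg (‖p x - p y‖ - ‖x - p x - (y - p y)‖)]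
    have h7 : μ * ‖x - p x - (y - p y)‖ ^ 2 ≤ l * ‖x - p x - (y - p y)‖ ^ 2 := by gcongr
    have h8 := mul_le_mul_of_nonneg_left h4 hμ.le
    rw [h.eq_prox x, h.eq_prox y]
    linarith
  · have hw' : ‖p x - w‖ ≤ ‖p x - p y‖ := by
      have := segment_subset_closedBall_left (p x) (p y) hw
      rwa [Metric.mem_closedBall, dist_comm, dist_eq_norm, dist_eq_norm] at this
    have := norm_sub_norm_le (p x) w
    linarith

lemma PhiUC.mollify {c R' : ℝ} (φ : ContDiffBump (0 : EuclideanSpace ℝ (Fin N)))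
    (hG : Continuous G) (h : PhiUC (fun _ => c) R G) (hR : R + φ.rOut ≤ R') :
    PhiUC (fun _ => c) R' (mollify φ G) := by
  intro z z' hseg θ hθ
  refine mollify_combo_le φ hG fun t ht => ?_
  have huc := h (z - t) (z' - t) (fun w hw => ?_) θ hθ
  · have h1 : θ • (z - t) + (1 - θ) • (z' - t) = θ • z + (1 - θ) • z' - t := by module
    rw [h1, sub_sub_sub_cancel_right] at huc
    exact huc
  · obtain ⟨a, b, ha, hb, hab, rfl⟩ := hw
    have h1 := hseg (a • z + b • z') ⟨a, b, ha, hb, hab, rfl⟩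
    have h2 : a • (z - t) + b • (z' - t) = a • z + b • z' - t := by
      obtain rfl : b = 1 - a := by linarith
      module
    rw [h2]
    have h3 := norm_sub_norm_le (a • z + b • z') t
    linarith

end PhiUC

/-- **Lemma A.4.** If `F` is convex and `μ`-uniformly convex outside `B_R`, there is a
nondecreasing sequence `{F_k}` of smooth convex functions converging to `F` uniformly on
bounded sets, with `F_k` `(μ/36)`-uniformly convex outside `B_{R+1}` for every `k ≥ 2R`. -/
theorem approximation_by_smooth_uniformly_convex
    {N : ℕ} (F : EuclideanSpace ℝ (Fin N) → ℝ) (μ R : ℝ)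
    (hμ : 0 < μ) (hR : 0 < R)
    (hFc : ConvexOn ℝ Set.univ F)
    (hFuc : PhiUC (fun _ => μ) R F) :
    ∃ Fk : ℕ → EuclideanSpace ℝ (Fin N) → ℝ,
      (∀ k, ContDiff ℝ (⊤ : ℕ∞) (Fk k)) ∧
      (∀ k, ConvexOn ℝ Set.univ (Fk k)) ∧
      (∀ k x, Fk k x ≤ Fk (k + 1) x) ∧
      (∀ s : Set (EuclideanSpace ℝ (Fin N)), Bornology.IsBounded s →
        TendstoUniformlyOn (fun k => Fk k) F atTop s) ∧
      (∀ k : ℕ, 2 * R ≤ (k : ℝ) → PhiUC (fun _ => μ / 36) (R + 1) (Fk k)) := by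
  have hcont : Continuous F := hFc.locallyLipschitz.continuous
  obtain ⟨M, hM⟩ := (isCompact_closedBall (0 : EuclideanSpace ℝ (Fin N))
    (R + 1)).exists_bound_of_continuousOn hcont.continuousOn
  have hM' : ∀ y, ‖y‖ ≤ R + 1 → |F y| ≤ M := fun y hy => hM y (mem_closedBall_zero_iff.2 hy)
  set l : ℕ → ℝ := fun k => max μ (64 * M) + k with hl
  have hlμ : ∀ k, μ ≤ l k := fun k => by
    have := le_max_left μ (64 * M)
    have : (0 : ℝ) ≤ k := k.cast_nonneg
    simp only [hl]; linarith
  have hlM : ∀ k, 64 * M ≤ l k := fun k => by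
    have := le_max_right μ (64 * M)
    have : (0 : ℝ) ≤ k := k.cast_nonneg
    simp only [hl]; linarith
  have hl0 : ∀ k, 0 < l k := fun k => hμ.trans_le (hlμ k)
  have hlmono : ∀ k, l k ≤ l (k + 1) := fun k => by simp [hl]
  have hltop : Tendsto l atTop atTop :=
    tendsto_atTop_add_const_left _ _ tendsto_natCast_atTop_atTop
  choose G p hG using fun k => hFc.exists_isMoreauEnvelope (hl0 k)
  have hGc : ∀ k, ConvexOn ℝ Set.univ (G k) := fun k => (hG k).convexOn (hl0 k).le hFc
  have hGcont : ∀ k, Continuous (G k) := fun k => (hGc k).locallyLipschitz.continuous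
  set δ : ℕ → ℝ := fun k => 1 / ((k : ℝ) + 1) with hδ
  have hδlt : ∀ k, δ (k + 1) < δ k := fun k => Nat.one_div_lt_one_div k.lt_succ_self
  have hδ0 : Tendsto δ atTop (𝓝 0) := tendsto_one_div_add_atTop_nhds_zero_nat
  have hφ : ∀ k, ∃ φ : ContDiffBump (0 : EuclideanSpace ℝ (Fin N)),
      φ.rOut ≤ 1 / 2 ∧ l k / 2 * φ.rOut ^ 2 ≤ δ k - δ (k + 1) := by
    intro k
    have hsmall : Tendsto (fun ε : ℝ => l k / 2 * ε ^ 2) (𝓝[>] 0) (𝓝 0) := by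
      have : Continuous fun ε : ℝ => l k / 2 * ε ^ 2 := by fun_prop
      simpa using (this.tendsto 0).mono_left nhdsWithin_le_nhds
    obtain ⟨ε, hε, hε2, hε0⟩ := ((hsmall.eventually_le_const (sub_pos.2 (hδlt k))).and
      ((eventually_nhdsWithin_of_eventually_nhds
        (eventually_le_nhds (by norm_num : (0 : ℝ) < 1 / 2))).and self_mem_nhdsWithin)).exists
    have hε0 : 0 < ε := hε0
    exact ⟨⟨ε / 2, ε, by linarith, by linarith⟩, hε2, hε⟩
  choose φ hφ2 hφδ using hφ
  have hlow : ∀ k x, G k x ≤ mollify (φ k) (G k) x := fun k => le_mollify _ (hGcont k) (hGc k)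
  have hupp : ∀ k x, mollify (φ k) (G k) x - δ k ≤ G k x - δ (k + 1) := fun k x => by
    have := mollify_le (φ k) (hGcont k) (hl0 k).le (hG k).add_le x
    linarith [hφδ k]
  have hmono : ∀ k x, mollify (φ k) (G k) x - δ k
      ≤ mollify (φ (k + 1)) (G (k + 1)) x - δ (k + 1) := fun k x => by
    linarith [hupp k x, (hG k).mono (hG (k + 1)) (hlmono k) x, hlow (k + 1) x]
  have hsmooth : ∀ k, ContDiff ℝ (⊤ : ℕ∞) fun x => mollify (φ k) (G k) x - δ k := fun k =>
    (contDiff_mollify (φ k) (hGcont k)).sub contDiff_const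
  refine ⟨fun k x => mollify (φ k) (G k) x - δ k, hsmooth, fun k => ?_, hmono, fun s hs => ?_,
    fun k _ => ?_⟩
  · exact (convexOn_mollify (φ k) (hGcont k) (hGc k)).sub (concaveOn_const (δ k) convex_univ)
  · have hunif : TendstoUniformlyOn (fun k x => mollify (φ k) (G k) x - δ k) F atTop
        (closure s) := by
      refine Monotone.tendstoUniformlyOn_of_forall_tendsto hs.isCompact_closure
        (fun k => (hsmooth k).continuous.continuousOn)
        (fun x _ => monotone_nat_of_le_succ fun k => hmono k x) hcont.continuousOn fun x _ => ?_
      have hGx := IsMoreauEnvelope.tendsto hFc hl0 hltop hG x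
      have h1 := hGx.sub hδ0
      have h2 := hGx.sub (hδ0.comp (tendsto_add_atTop_nat 1))
      rw [sub_zero] at h1 h2
      exact tendsto_of_tendsto_of_tendsto_of_le_of_le h1 h2
        (fun k => sub_le_sub_right (hlow k x) _) fun k => hupp k x
    exact hunif.mono subset_closure
  · have huc := ((hG k).phiUC hμ hFc hFuc hM' (hlM k) (hlμ k)
      (by linarith : μ / 36 < μ / 2)).mollify (φ k) (hGcont k)
      (by linarith [hφ2 k] : R + 1 / 2 + (φ k).rOut ≤ R + 1)
    intro z z' hseg θ hθ
    have := huc z z' hseg θ hθ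
    simp only at this ⊢
    linarith

end
end

section
/- Let F : ℝ^N → ℝ be a convex function which is Φ-uniformly convex outside the ball B_R. Then for every Q > R there exists a convex function F_Q : ℝ^N → ℝ such that: (i) F_Q coincides with F on B_Q; and (ii) F_Q is μ_Q-uniformly convex outside the ball B_R, where μ_Q = min{1, min_{t ∈ [2R, 4Q]} Φ(t)} > 0. -/
open MeasureTheory Filter
open scoped InnerProductSpace RealInnerProductSpace ENNReal NNReal Topology

noncomputable section

theorem norm_sq_convex_combination {E : Type*} [NormedAddCommGroup E] [InnerProductSpace ℝ E]
    (z z' : E) (θ : ℝ) :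
    ‖θ • z + (1 - θ) • z'‖ ^ 2 =
      θ * ‖z‖ ^ 2 + (1 - θ) * ‖z'‖ ^ 2 - θ * (1 - θ) * ‖z - z'‖ ^ 2 := by
  rw [norm_add_sq_real, norm_sub_sq_real, norm_smul, norm_smul, mul_pow, mul_pow,
    real_inner_smul_left, real_inner_smul_right, Real.norm_eq_abs, Real.norm_eq_abs, sq_abs,
    sq_abs]
  ring

/-- A continuous function with a value at most `q` at `a` either is at most `q` at `b`, or takes
the value `q` between `a` and `b`. -/
theorem exists_mem_uIcc_le_and_eq_or {f : ℝ → ℝ} (hf : Continuous f) {a b q : ℝ}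
    (ha : f a ≤ q) : ∃ c ∈ Set.uIcc a b, f c ≤ q ∧ (f c = q ∨ c = b) := by
  rcases le_total (f b) q with hb | hb
  · exact ⟨b, Set.right_mem_uIcc, hb, Or.inr rfl⟩
  · obtain ⟨c, hc, hcq⟩ :=
      intermediate_value_uIcc hf.continuousOn (Set.mem_uIcc_of_le ha hb)
    exact ⟨c, hc, hcq.le, Or.inl hcq⟩

theorem bddBelow_image_and_sInf_pos {Φ : ℝ → ℝ} {a b : ℝ} (ha : 0 < a) (hab : a ≤ b)
    (hpos : ∀ t, 0 < t → 0 < Φ t) (hcont : ContinuousOn Φ (Set.Ioi 0)) :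
    BddBelow (Φ '' Set.Icc a b) ∧ 0 < sInf (Φ '' Set.Icc a b) := by
  have hcomp : IsCompact (Φ '' Set.Icc a b) :=
    isCompact_Icc.image_of_continuousOn (hcont.mono fun t ht => ha.trans_le ht.1)
  refine ⟨hcomp.bddBelow, ?_⟩
  obtain ⟨t, ht, hts⟩ := hcomp.sInf_mem ((Set.nonempty_Icc.2 hab).image Φ)
  rw [← hts]
  exact hpos t (ha.trans_le ht.1)

/-- If `F` is uniformly convex with modulus `μ` along segments in the closed ball of radius `Q`
outside `B_R`, then `F - (μ / 2) min (|x|², Q²)` is convex along all segments outside `B_R`. -/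
theorem sub_min_norm_sq_le {N : ℕ} {F : EuclideanSpace ℝ (Fin N) → ℝ} {R Q μ : ℝ}
    (hQ : 0 < Q) (hμ : 0 ≤ μ) (hFc : ConvexOn ℝ Set.univ F)
    (hF : ∀ y y' : EuclideanSpace ℝ (Fin N), (∀ w ∈ segment ℝ y y', R ≤ ‖w‖) → ‖y‖ ≤ Q →
      ‖y'‖ ≤ Q → ∀ θ ∈ Set.Icc (0 : ℝ) 1, F (θ • y + (1 - θ) • y') ≤
        θ * F y + (1 - θ) * F y' - (1 / 2) * θ * (1 - θ) * μ * ‖y - y'‖ ^ 2)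
    {z z' : EuclideanSpace ℝ (Fin N)} (hz : ∀ w ∈ segment ℝ z z', R ≤ ‖w‖)
    {θ : ℝ} (hθ : θ ∈ Set.Icc (0 : ℝ) 1) :
    F (θ • z + (1 - θ) • z') - μ / 2 * min (‖θ • z + (1 - θ) • z'‖ ^ 2) (Q ^ 2) ≤
      θ * (F z - μ / 2 * min (‖z‖ ^ 2) (Q ^ 2)) +
        (1 - θ) * (F z' - μ / 2 * min (‖z'‖ ^ 2) (Q ^ 2)) := by
  set g : EuclideanSpace ℝ (Fin N) → ℝ := fun x => F x - μ / 2 * min (‖x‖ ^ 2) (Q ^ 2) with hg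
  set p : ℝ → EuclideanSpace ℝ (Fin N) := fun a => a • z + (1 - a) • z' with hp
  change g (p θ) ≤ θ * g z + (1 - θ) * g z'
  have hp1 : p 1 = z := by simp [hp]
  have hp0 : p 0 = z' := by simp [hp]
  have hpc : Continuous fun a => ‖p a‖ := by fun_prop
  have hpseg : ∀ a ∈ Set.Icc (0 : ℝ) 1, p a ∈ segment ℝ z z' := fun a ha =>
    ⟨a, 1 - a, ha.1, sub_nonneg.2 ha.2, by ring, rfl⟩
  have hg_ge : ∀ x, F x - μ / 2 * Q ^ 2 ≤ g x := fun x => by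
    have := mul_le_mul_of_nonneg_left (min_le_right (‖x‖ ^ 2) (Q ^ 2)) (div_nonneg hμ zero_le_two)
    simp only [hg]
    linarith
  have hg_in : ∀ x, ‖x‖ ≤ Q → g x = F x - μ / 2 * ‖x‖ ^ 2 := fun x hx => by
    simp only [hg]
    rw [min_eq_left (by gcongr)]
  have h_out : ∀ a ∈ Set.Icc (0 : ℝ) 1, Q ≤ ‖p a‖ → g (p a) ≤ a * g z + (1 - a) * g z' := by
    intro a ha hQa
    have hga : g (p a) = F (p a) - μ / 2 * Q ^ 2 := by
      simp only [hg]
      rw [min_eq_right (by gcongr)]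
    have hconv : F (p a) ≤ a * F z + (1 - a) * F z' :=
      hFc.2 (Set.mem_univ z) (Set.mem_univ z') ha.1 (sub_nonneg.2 ha.2) (by ring)
    have h1 := mul_le_mul_of_nonneg_left (hg_ge z) ha.1
    have h2 := mul_le_mul_of_nonneg_left (hg_ge z') (sub_nonneg.2 ha.2)
    linarith
  rcases le_total Q ‖p θ‖ with hQθ | hθQ
  · exact h_out θ hθ hQθ
  obtain ⟨a, ha, haQ, ha'⟩ := exists_mem_uIcc_le_and_eq_or hpc (b := 1) hθQ
  obtain ⟨b, hb, hbQ, hb'⟩ := exists_mem_uIcc_le_and_eq_or hpc (b := 0) hθQ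
  rw [Set.uIcc_of_le hθ.2] at ha
  rw [Set.uIcc_of_ge hθ.1] at hb
  have ha01 : a ∈ Set.Icc (0 : ℝ) 1 := ⟨hθ.1.trans ha.1, ha.2⟩
  have hb01 : b ∈ Set.Icc (0 : ℝ) 1 := ⟨hb.1, hb.2.trans hθ.2⟩
  have hga : g (p a) ≤ a * g z + (1 - a) * g z' := by
    rcases ha' with h | rfl
    · exact h_out a ha01 h.ge
    · simp [hp1]
  have hgb : g (p b) ≤ b * g z + (1 - b) * g z' := by
    rcases hb' with h | rfl
    · exact h_out b hb01 h.ge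
    · simp [hp0]
  obtain ⟨s, t, hs, ht, hst, hsum⟩ : θ ∈ segment ℝ a b := by
    rw [segment_symm, segment_eq_Icc (hb.2.trans ha.1)]
    exact ⟨hb.2, ha.1⟩
  obtain rfl : t = 1 - s := by linarith
  have hsum' : s * a + (1 - s) * b = θ := hsum
  have hcomb : s • p a + (1 - s) • p b = p θ := by
    simp only [hp, ← hsum']
    module
  have hloc : g (p θ) ≤ s * g (p a) + (1 - s) * g (p b) := by
    have h1 := hF (p a) (p b)
      (fun w hw => hz w ((convex_segment z z').segment_subset (hpseg a ha01) (hpseg b hb01) hw))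
      haQ hbQ s ⟨hs, by linarith⟩
    have h2 := norm_sq_convex_combination (p a) (p b) s
    rw [hcomb] at h1 h2
    rw [hg_in _ haQ, hg_in _ hbQ, hg_in _ hθQ, h2]
    linarith
  calc g (p θ) ≤ s * g (p a) + (1 - s) * g (p b) := hloc
    _ ≤ s * (a * g z + (1 - a) * g z') + (1 - s) * (b * g z + (1 - b) * g z') := by gcongr
    _ = θ * g z + (1 - θ) * g z' := by rw [← hsum']; ring

theorem convexOn_add_max_norm_sq_sub {E : Type*} [NormedAddCommGroup E] [NormedSpace ℝ E]
    {F : E → ℝ} (hF : ConvexOn ℝ Set.univ F) {c : ℝ} (hc : 0 ≤ c) (q : ℝ) :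
    ConvexOn ℝ Set.univ fun x => F x + c * max (‖x‖ ^ 2 - q) 0 := by
  have h1 : ConvexOn ℝ Set.univ fun x : E => ‖x‖ ^ 2 :=
    convexOn_univ_norm.pow (fun x _ => norm_nonneg x) 2
  have h2 : ConvexOn ℝ Set.univ fun x : E => ‖x‖ ^ 2 - q :=
    h1.sub (concaveOn_const q convex_univ)
  exact hF.add ((h2.sup (convexOn_const 0 convex_univ)).smul hc)

/-- **Lemma A.5.** If `F` is convex and `Φ`-uniformly convex outside `B_R`, then for every
`Q > R` there is a convex `F_Q` coinciding with `F` on `B_Q` which is `μ_Q`-uniformly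
convex outside `B_R`, where `μ_Q = min{1, min_{t∈[2R,4Q]} Φ(t)} > 0`. -/
theorem truncation_to_mu_uniformly_convex
    {N : ℕ} (F : EuclideanSpace ℝ (Fin N) → ℝ) (Φ : ℝ → ℝ) (R Q : ℝ)
    (hR : 0 < R) (hQ : R < Q)
    (hΦpos : ∀ t, 0 < t → 0 < Φ t) (hΦcont : ContinuousOn Φ (Set.Ioi 0))
    (hFc : ConvexOn ℝ Set.univ F)
    (hFuc : PhiUC Φ R F) :
    0 < min 1 (sInf (Φ '' Set.Icc (2 * R) (4 * Q))) ∧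
    ∃ FQ : EuclideanSpace ℝ (Fin N) → ℝ,
      ConvexOn ℝ Set.univ FQ ∧
      (∀ x ∈ Metric.ball (0 : EuclideanSpace ℝ (Fin N)) Q, FQ x = F x) ∧
      PhiUC (fun _ => min 1 (sInf (Φ '' Set.Icc (2 * R) (4 * Q)))) R FQ := by
  obtain ⟨hbdd, hinf⟩ := bddBelow_image_and_sInf_pos (a := 2 * R) (b := 4 * Q)
    (by linarith) (by linarith) hΦpos hΦcont
  set μ := min 1 (sInf (Φ '' Set.Icc (2 * R) (4 * Q))) with hμdef
  have hμ : 0 < μ := lt_min one_pos hinf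
  have hμΦ : ∀ t ∈ Set.Icc (2 * R) (4 * Q), μ ≤ Φ t := fun t ht =>
    (min_le_right _ _).trans (csInf_le hbdd ⟨t, ht, rfl⟩)
  have hQ0 : 0 < Q := hR.trans hQ
  refine ⟨hμ, fun x => F x + μ / 2 * max (‖x‖ ^ 2 - Q ^ 2) 0,
    convexOn_add_max_norm_sq_sub hFc (by positivity) _, fun x hx => ?_, ?_⟩
  · have hxQ : ‖x‖ ^ 2 ≤ Q ^ 2 := by
      have := (mem_ball_zero_iff.1 hx).le
      gcongr
    simp [max_eq_right (sub_nonpos.2 hxQ)]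
  · intro z z' hz θ hθ
    have hmax : ∀ x : EuclideanSpace ℝ (Fin N),
        max (‖x‖ ^ 2 - Q ^ 2) 0 = ‖x‖ ^ 2 - min (‖x‖ ^ 2) (Q ^ 2) := fun x => by
      rw [← sub_self (Q ^ 2), max_sub_sub_right]
      linarith [min_add_max (‖x‖ ^ 2) (Q ^ 2)]
    have hmin := sub_min_norm_sq_le hQ0 hμ.le hFc (fun y y' hy hyQ hy'Q s hs => by
      have h1 := hy y (left_mem_segment ℝ y y')
      have h2 := hy y' (right_mem_segment ℝ y y')
      have h3 := hμΦ (‖y‖ + ‖y'‖) ⟨by linarith, by linarith⟩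
      have hs0 := hs.1
      have hs1 : 0 ≤ 1 - s := sub_nonneg.2 hs.2
      refine (hFuc y y' hy s hs).trans ?_
      gcongr) hz hθ
    have hsq := norm_sq_convex_combination z z' θ
    simp only [hmax]
    rw [hsq] at hmin ⊢
    linarith

end
end
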